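/- Let N ≥ 1, k ≥ 1, let χ be a Dirichlet character modulo N of conductor m, with χ₀ the primitive Dirichlet character modulo m inducing χ, let f ∈ M_k(Γ₀(N), χ), and let g = (A, B; C, D) ∈ SL₂(ℤ). Set N' = N/gcd(CD, N), m' = m/gcd(BC, m), K = K_f(ζ_{N'}), and let G' = {μ ∈ (ℤ/m'ℤ)^× : the ℚ-algebra automorphism of ℚ(ζ_{m'}) sending ζ_{m'} to ζ_{m'}^μ fixes K ∩ ℚ(ζ_{m'}) pointwise}. For an m'-th root of unity ζ put c(ζ) = Σ_{μ ∈ G'} χ₀(AD − μ̃BC) ζ^{μ̃}, where μ̃ ∈ ℤ is any lift of μ (each summand is independent of the chosen lift). Then there exists an m'-th root of unity ζ with c(ζ) ≠ 0, and for every m'-th root of unity ζ with c(ζ) ≠ 0, every Fourier coefficient of f |_k g (in its expansion Σ_{n≥0} c_n e^{2πinτ/N}) lies in the set c(ζ)·K = {c(ζ)·t : t ∈ K}. -/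

import Mathlib

open Complex UpperHalfPlane CongruenceSubgroup
open scoped ModularForm MatrixGroups Real

noncomputable section

/-- `ζ_N = e^{2πi/N}`. -/
def zetaC (N : ℕ) : ℂ := Complex.exp (2 * Real.pi * Complex.I / N)

/-- `f` has the Fourier expansion `Σ_{n ≥ 0} c n · e^{2πinτ/N}`. -/
def HasExpansion (N : ℕ) (f : ℍ → ℂ) (c : ℕ → ℂ) : Prop :=
  ∀ τ : ℍ, HasSum (fun n : ℕ => c n * Complex.exp (2 * Real.pi * Complex.I * n * (τ : ℂ) / N)) (f τ)

/-- The cyclotomic field `ℚ(ζ_{m'})`, as a subfield of `ℂ`. -/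
def Qzeta (m' : ℕ) : Subfield ℂ := Subfield.closure {zetaC m'}

/-- `u` represents an element of `G'`: the `ℚ`-algebra automorphism of `ℚ(ζ_{m'})` sending
`ζ_{m'}` to `ζ_{m'}^u` fixes `K ∩ ℚ(ζ_{m'})` pointwise. -/
def autFixes (m' : ℕ) (K : Subfield ℂ) (u : ℕ) : Prop :=
  ∃ e : Qzeta m' ≃+* Qzeta m',
    (e ⟨zetaC m', Subfield.subset_closure rfl⟩ : ℂ) = zetaC m' ^ u ∧
    ∀ x : Qzeta m', (x : ℂ) ∈ K → e x = x

open scoped Classical in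
/-- The sum `c(ζ) = Σ_{μ ∈ G'} χ₀(AD − μ̃BC) ζ^{μ̃}`, where each `μ ∈ G' ⊆ (ℤ/m'ℤ)ˣ` is
represented by its canonical lift `μ̃ = u ∈ {0, …, m'−1}`. -/
def cSum (m m' : ℕ) (χ₀ : DirichletCharacter ℂ m) (A B C D : ℤ) (K : Subfield ℂ)
    (ζ : ℂ) : ℂ :=
  ∑ u ∈ Finset.range m',
    if IsUnit ((u : ℕ) : ZMod m') ∧ autFixes m' K u
      then χ₀ (((A * D - (u : ℤ) * B * C : ℤ) : ZMod m)) * ζ ^ u else 0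

section Part1
open scoped Manifold
/-- `F` has the `q_M`-expansion given by the power series `p`. -/
def HasPS (M : ℕ) (F : ℍ → ℂ) (p : PowerSeries ℂ) : Prop :=
  HasExpansion M F (fun n => PowerSeries.coeff n p)

lemma hasPS_iff {M : ℕ} {F : ℍ → ℂ} {p : PowerSeries ℂ} :
    HasPS M F p ↔ ∀ τ : ℍ, HasSum (fun n => PowerSeries.coeff n p *
      Function.Periodic.qParam M τ ^ n) (F τ) := by
  unfold HasPS HasExpansion
  refine forall_congr' fun τ => ?_
  have : (fun n : ℕ => PowerSeries.coeff n p * cexp (2 * π * Complex.I * n * τ / M)) =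
      (fun n => PowerSeries.coeff n p * Function.Periodic.qParam M τ ^ n) := by
    funext n
    rw [Function.Periodic.qParam, ← Complex.exp_nat_mul]
    congr 2
    push_cast
    ring
  rw [this]

lemma hasPS_of_hasExpansion {M : ℕ} {F : ℍ → ℂ} {c : ℕ → ℂ} (h : HasExpansion M F c) :
    HasPS M F (PowerSeries.mk c) := by
  simpa [HasPS] using h

lemma HasPS.hasSum_q {M : ℕ} (hM : 0 < M) {F : ℍ → ℂ} {p : PowerSeries ℂ} (h : HasPS M F p)
    {q : ℂ} (hq : ‖q‖ < 1) : Summable (fun n => PowerSeries.coeff n p * q ^ n) := by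
  rcases eq_or_ne q 0 with rfl | hq0
  · apply summable_of_ne_finset_zero (s := {0})
    intro n hn
    simp at hn
    simp [hn]
  · have hM' : (0 : ℝ) < M := by exact_mod_cast hM
    have h1 := Function.Periodic.im_invQParam_pos_of_norm_lt_one hM' hq hq0
    have := (hasPS_iff.1 h ⟨_, h1⟩).summable
    simpa [Function.Periodic.qParam_right_inv hM'.ne' hq0] using this

lemma HasPS.fps {M : ℕ} (hM : 0 < M) {F : ℍ → ℂ} {p : PowerSeries ℂ} (h : HasPS M F p) :
    HasFPowerSeriesOnBall (fun q => ∑' n, PowerSeries.coeff n p * q ^ n)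
      (.ofScalars ℂ (fun n => PowerSeries.coeff n p)) 0 1 := by
  constructor
  · refine le_of_forall_lt_imp_le_of_dense fun r hr ↦ ?_
    lift r to NNReal using hr.ne_top
    apply FormalMultilinearSeries.le_radius_of_summable
    have := (h.hasSum_q hM (q := (r : ℂ)) (by simpa using hr)).norm
    simpa [norm_mul, mul_comm, mul_left_comm, mul_assoc] using this
  · simp
  · intro y hy
    rw [← ENNReal.coe_one, Metric.eball_coe, NNReal.coe_one, mem_ball_zero_iff] at hy
    simpa [mul_comm] using (h.hasSum_q hM hy).hasSum

lemma HasPS.eq_tsum {M : ℕ} {F : ℍ → ℂ} {p : PowerSeries ℂ} (h : HasPS M F p) (τ : ℍ) :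
    F τ = ∑' n, PowerSeries.coeff n p * Function.Periodic.qParam M τ ^ n :=
  ((hasPS_iff.1 h) τ).tsum_eq.symm

lemma HasPS.unique {M : ℕ} (hM : 0 < M) {F : ℍ → ℂ} {p p' : PowerSeries ℂ} (h : HasPS M F p)
    (h' : HasPS M F p') : p = p' := by
  have hM' : (0 : ℝ) < M := by exact_mod_cast hM
  have H := (h.fps hM).hasFPowerSeriesAt
  have H' := (h'.fps hM).hasFPowerSeriesAt
  have key : (fun q : ℂ => ∑' n, PowerSeries.coeff n p * q ^ n) =ᶠ[nhds 0]
      (fun q => ∑' n, PowerSeries.coeff n p' * q ^ n) := by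
    refine (H.continuousAt.eventuallyEq_nhds_iff_eventuallyEq_nhdsNE H'.continuousAt).mp ?_
    have : Metric.ball (0:ℂ) 1 ∈ nhdsWithin (0:ℂ) {0}ᶜ :=
      mem_nhdsWithin_of_mem_nhds (Metric.ball_mem_nhds _ one_pos)
    filter_upwards [self_mem_nhdsWithin, this] with q hq hq1
    have hq1 : ‖q‖ < 1 := by simpa using hq1
    have hq0 : q ≠ 0 := hq
    have h1 := Function.Periodic.im_invQParam_pos_of_norm_lt_one hM' hq1 hq0
    have e1 := h.eq_tsum ⟨_, h1⟩
    have e2 := h'.eq_tsum ⟨_, h1⟩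
    simp only [Function.Periodic.qParam_right_inv hM'.ne' hq0] at e1 e2
    exact e1.symm.trans e2
  have := (H.congr key).eq_formalMultilinearSeries H'
  have := FormalMultilinearSeries.ofScalars_series_injective ℂ ℂ this
  ext n
  exact congrFun this n

lemma HasPS.func_eq {M : ℕ} {F F' : ℍ → ℂ} {p : PowerSeries ℂ} (h : HasPS M F p)
    (h' : HasPS M F' p) : F = F' := by
  funext τ
  rw [h.eq_tsum, h'.eq_tsum]

lemma HasPS.mdiff {M : ℕ} (hM : 0 < M) {F : ℍ → ℂ} {p : PowerSeries ℂ} (h : HasPS M F p) :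
    MDiff F := by
  have hM' : (0 : ℝ) < M := by exact_mod_cast hM
  rw [UpperHalfPlane.mdifferentiable_iff]
  have h1 : DifferentiableOn ℂ (fun z : ℂ => (fun q => ∑' n, PowerSeries.coeff n p * q ^ n)
      (Function.Periodic.qParam M z)) {z | 0 < z.im} := by
    intro z hz
    refine DifferentiableAt.differentiableWithinAt ?_
    refine DifferentiableAt.comp z (g := (fun q => ∑' n, PowerSeries.coeff n p * q ^ n)) ?_ ?_
    · refine (h.fps hM).differentiableOn.differentiableAt ?_
      refine Metric.isOpen_eball.mem_nhds ?_
      rw [← ENNReal.coe_one, Metric.eball_coe, NNReal.coe_one, mem_ball_zero_iff]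
      exact Function.Periodic.norm_qParam_lt_one hM' hz
    · unfold Function.Periodic.qParam; fun_prop
  refine h1.congr fun z hz => ?_
  simp only [Function.comp]
  rw [h.eq_tsum, ofComplex_apply_of_im_pos hz]

lemma HasPS.bdd {M : ℕ} (hM : 0 < M) {F : ℍ → ℂ} {p : PowerSeries ℂ} (h : HasPS M F p) :
    IsBoundedAtImInfty F := by
  have hM' : (0 : ℝ) < M := by exact_mod_cast hM
  exact isBoundedAtImInfty_of_hasSum_qExpansion hM' (hasPS_iff.1 h)

lemma HasPS.add {M : ℕ} {F G : ℍ → ℂ} {p r : PowerSeries ℂ} (h : HasPS M F p)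
    (h' : HasPS M G r) : HasPS M (F + G) (p + r) := by
  rw [hasPS_iff] at *
  intro τ
  simpa [add_mul] using (h τ).add (h' τ)

lemma HasPS.smul {M : ℕ} {F : ℍ → ℂ} {p : PowerSeries ℂ} (a : ℂ) (h : HasPS M F p) :
    HasPS M (a • F) (a • p) := by
  rw [hasPS_iff] at *
  intro τ
  simpa [mul_assoc] using (h τ).mul_left a

lemma HasPS.zero (M : ℕ) : HasPS M 0 0 := by
  rw [hasPS_iff]
  intro τ
  simpa using hasSum_zero

lemma HasPS.const (M : ℕ) (a : ℂ) : HasPS M (fun _ => a) (PowerSeries.C a) := by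
  rw [hasPS_iff]
  intro τ
  have := hasSum_ite_eq (0:ℕ) a
  refine this.congr_fun fun n => ?_
  by_cases hn : n = 0 <;> simp [hn, PowerSeries.coeff_C]

lemma HasPS.mul {M : ℕ} {F G : ℍ → ℂ} {p r : PowerSeries ℂ} (h : HasPS M F p)
    (h' : HasPS M G r) : HasPS M (F * G) (p * r) := by
  rw [hasPS_iff] at *
  intro τ
  have s1 := (h τ).summable.norm
  have s2 := (h' τ).summable.norm
  have e := tsum_mul_tsum_eq_tsum_sum_antidiagonal_of_summable_norm s1 s2
  have s3 := (summable_norm_sum_mul_antidiagonal_of_summable_norm s1 s2).of_norm.hasSum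
  rw [← e, (h τ).tsum_eq, (h' τ).tsum_eq] at s3
  refine s3.congr_fun fun n => ?_
  rw [PowerSeries.coeff_mul, Finset.sum_mul]
  refine Finset.sum_congr rfl fun x hx => ?_
  rw [← Finset.HasAntidiagonal.mem_antidiagonal.1 hx, pow_add]
  ring

/-- Rescaling the level of an expansion. -/
def upPS (d : ℕ) (p : PowerSeries ℂ) : PowerSeries ℂ :=
  PowerSeries.mk fun n => if d ∣ n then PowerSeries.coeff (n / d) p else 0

lemma coeff_upPS (d : ℕ) (hd : 0 < d) (p : PowerSeries ℂ) (n : ℕ) :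
    PowerSeries.coeff (d * n) (upPS d p) = PowerSeries.coeff n p := by
  simp [upPS, Nat.mul_div_cancel_left _ hd]

lemma map_upPS (d : ℕ) (p : PowerSeries ℂ) (σ : ℂ →+* ℂ) :
    PowerSeries.map σ (upPS d p) = upPS d (PowerSeries.map σ p) := by
  ext n
  simp only [upPS, PowerSeries.coeff_map, PowerSeries.coeff_mk]
  split_ifs <;> simp

lemma HasPS.up {M : ℕ} {F : ℍ → ℂ} {p : PowerSeries ℂ} (h : HasPS M F p) {d : ℕ} (hd : 0 < d) :
    HasPS (d * M) F (upPS d p) := by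
  rw [hasPS_iff] at *
  intro τ
  have inj : Function.Injective (fun n : ℕ => d * n) := fun a b hab =>
    Nat.eq_of_mul_eq_mul_left hd hab
  rw [← inj.hasSum_iff]
  · convert h τ using 2 with n
    simp only [Function.comp, coeff_upPS d hd]
    congr 1
    rw [pow_mul, Function.Periodic.qParam, Function.Periodic.qParam, ← Complex.exp_nat_mul]
    congr 2
    have : (d : ℂ) ≠ 0 := by exact_mod_cast hd.ne'
    push_cast
    rcases eq_or_ne (M : ℂ) 0 with h0 | h0
    · simp [h0]
    · field_simp
  · intro n hn
    have : ¬ d ∣ n := fun ⟨k, hk⟩ => hn ⟨k, hk.symm⟩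
    simp [upPS, this]

lemma hasPS_of_periodic {M : ℕ} (hM : 0 < M) {F : ℍ → ℂ} (hd : MDiff F)
    (hb : IsBoundedAtImInfty F) (hp : ∀ τ : ℍ, F ((M : ℝ) +ᵥ τ) = F τ) :
    ∃ p, HasPS M F p := by
  have hM' : (0 : ℝ) < M := by exact_mod_cast hM
  refine ⟨qExpansion M F, hasPS_iff.2 fun τ => ?_⟩
  refine hasSum_qExpansion hM' ?_ hd hb τ
  intro w
  by_cases hw : 0 < im w
  · have : 0 < im (w + M) := by simp [hw]
    have h2 : 0 < im (w + (M:ℝ)) := by simp [hw]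
    simp only [Function.comp_apply]
    rw [ofComplex_apply_of_im_pos hw, ofComplex_apply_of_im_pos h2, ← hp ⟨w, hw⟩]
    congr 1
    ext
    simp [add_comm]
  · have h2 : im (w + (M:ℝ)) ≤ 0 := by simpa using hw
    simp only [Function.comp_apply]
    rw [ofComplex_apply_of_im_nonpos h2, ofComplex_apply_of_im_nonpos (not_lt.1 hw)]
end Part1

section Part2
open scoped Manifold
/-- `γ'` is congruent mod `M` to the conjugate of `γ` by `diag(1, l)`. -/
def ConjBy (M : ℕ) (l : (ZMod M)ˣ) (γ γ' : SL(2, ℤ)) : Prop :=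
  ((γ' 0 0 : ℤ) : ZMod M) = (γ 0 0 : ℤ) ∧ ((γ' 0 1 : ℤ) : ZMod M) = l * (γ 0 1 : ℤ) ∧
  (l : ZMod M) * ((γ' 1 0 : ℤ) : ZMod M) = (γ 1 0 : ℤ) ∧
    ((γ' 1 1 : ℤ) : ZMod M) = (γ 1 1 : ℤ)

/-- `F'` is the `σ`-conjugate of `F` compatibly with all slash translates. -/
def SRel (M : ℕ) (σ : ℂ →+* ℂ) (l : (ZMod M)ˣ) (w : ℤ) (F F' : ℍ → ℂ) : Prop :=
  ∀ γ γ' : SL(2, ℤ), ConjBy M l γ γ' →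
    ∃ p, HasPS M (F ∣[w] γ) p ∧ HasPS M (F' ∣[w] γ') (PowerSeries.map σ p)

section
variable {M : ℕ} {σ : ℂ →+* ℂ} {l : (ZMod M)ˣ}

lemma SRel.mul {w v : ℤ} {F F' G G' : ℍ → ℂ} (h : SRel M σ l w F F') (h' : SRel M σ l v G G') :
    SRel M σ l (w + v) (F * G) (F' * G') := by
  intro γ γ' hγ
  obtain ⟨p, hp, hp'⟩ := h γ γ' hγ
  obtain ⟨r, hr, hr'⟩ := h' γ γ' hγ
  refine ⟨p * r, ?_, ?_⟩
  · rw [ModularForm.mul_slash_SL2]; exact hp.mul hr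
  · rw [ModularForm.mul_slash_SL2, map_mul]; exact hp'.mul hr'

lemma SRel.add {w : ℤ} {F F' G G' : ℍ → ℂ} (h : SRel M σ l w F F') (h' : SRel M σ l w G G') :
    SRel M σ l w (F + G) (F' + G') := by
  intro γ γ' hγ
  obtain ⟨p, hp, hp'⟩ := h γ γ' hγ
  obtain ⟨r, hr, hr'⟩ := h' γ γ' hγ
  refine ⟨p + r, ?_, ?_⟩
  · rw [SlashAction.add_slash]; exact hp.add hr
  · rw [SlashAction.add_slash, map_add]; exact hp'.add hr'

lemma SRel.smul {w : ℤ} {F F' : ℍ → ℂ} (a : ℂ) (h : SRel M σ l w F F') :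
    SRel M σ l w (a • F) (σ a • F') := by
  intro γ γ' hγ
  obtain ⟨p, hp, hp'⟩ := h γ γ' hγ
  refine ⟨a • p, ?_, ?_⟩
  · rw [ModularForm.SL_smul_slash]; exact hp.smul a
  · rw [ModularForm.SL_smul_slash]
    convert hp'.smul (σ a)
    ext n
    simp

lemma SRel.sub {w : ℤ} {F F' G G' : ℍ → ℂ} (h : SRel M σ l w F F') (h' : SRel M σ l w G G') :
    SRel M σ l w (F - G) (F' - G') := by
  have := h.add (h'.smul (-1))
  simpa [sub_eq_add_neg] using this

lemma SRel.zero (w : ℤ) : SRel M σ l w 0 0 := by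
  intro γ γ' _
  refine ⟨0, ?_, ?_⟩
  · rw [SlashAction.zero_slash]; exact HasPS.zero M
  · rw [SlashAction.zero_slash, map_zero]; exact HasPS.zero M

lemma SRel.one : SRel M σ l 0 1 1 := by
  intro γ γ' _
  have h : HasPS M 1 1 := by
    have := HasPS.const M 1
    rw [map_one] at this
    exact this
  refine ⟨1, ?_, ?_⟩
  · rw [ModularForm.is_invariant_one]; exact h
  · rw [ModularForm.is_invariant_one, map_one]; exact h

lemma SRel.sum {ι : Type*} (s : Finset ι) {w : ℤ} {F F' : ι → ℍ → ℂ}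
    (h : ∀ i ∈ s, SRel M σ l w (F i) (F' i)) :
    SRel M σ l w (∑ i ∈ s, F i) (∑ i ∈ s, F' i) := by
  classical
  induction s using Finset.induction_on with
  | empty => simpa using SRel.zero w
  | insert i s hi ih =>
    rw [Finset.sum_insert hi, Finset.sum_insert hi]
    exact (h i (by simp)).add (ih fun j hj => h j (by simp [hj]))

lemma SRel.prod {ι : Type*} (s : Finset ι) {w : ℤ} {F F' : ι → ℍ → ℂ}
    (h : ∀ i ∈ s, SRel M σ l w (F i) (F' i)) :
    SRel M σ l (s.card * w) (∏ i ∈ s, F i) (∏ i ∈ s, F' i) := by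
  classical
  induction s using Finset.induction_on with
  | empty => simpa using SRel.one
  | insert i s hi ih =>
    rw [Finset.prod_insert hi, Finset.prod_insert hi, Finset.card_insert_of_notMem hi]
    have := (h i (by simp)).mul (ih fun j hj => h j (by simp [hj]))
    convert this using 1
    push_cast
    ring

lemma rel_of_invariant (hM : 0 < M) {w : ℤ} {F : ℍ → ℂ} {p : PowerSeries ℂ}
    (hF : ∀ γ : SL(2, ℤ), F ∣[w] γ = F)
    (hp : HasPS 1 F p) (hσ : PowerSeries.map σ p = p) : SRel M σ l w F F := by
  intro γ γ' _
  rw [hF, hF]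
  have := hp.up hM
  rw [mul_one] at this
  exact ⟨_, this, by rw [map_upPS, hσ]; exact this⟩
end

open ModularForm EisensteinSeries

lemma levelOne_inv {w : ℤ} (t : ModularForm 𝒮ℒ w) (γ : SL(2, ℤ)) : (⇑t) ∣[w] γ = ⇑t := by
  exact t.slash_action_eq' _ ⟨γ, rfl⟩

lemma levelOne_hasPS {w : ℤ} (t : ModularForm 𝒮ℒ w) : HasPS 1 t (qExpansion 1 t) := by
  rw [hasPS_iff]
  intro τ
  simpa using ModularForm.hasSum_qExpansion (h := 1) t one_pos one_mem_strictPeriods_SL τ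

lemma rel_E {M : ℕ} {σ : ℂ →+* ℂ} {l : (ZMod M)ˣ} (hM : 0 < M) {k : ℕ} (hk : 3 ≤ k)
    (hk2 : Even k) : SRel M σ l k (E hk) (E hk) := by
  refine rel_of_invariant hM (levelOne_inv _) (levelOne_hasPS _) ?_
  ext n
  rw [PowerSeries.coeff_map, E_qExpansion_coeff hk hk2]
  have h2 : σ 2 = 2 := map_ofNat σ 2
  split_ifs <;> simp [h2]

lemma rel_disc {M : ℕ} {σ : ℂ →+* ℂ} {l : (ZMod M)ˣ} (hM : 0 < M) :
    SRel M σ l 12 discriminant discriminant := by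
  have h4 : SRel M σ l 4 E₄ E₄ := rel_E hM (k := 4) (by norm_num) (by decide)
  have h6 : SRel M σ l 6 E₆ E₆ := rel_E hM (k := 6) (by norm_num) (by decide)
  have h44 : SRel M σ l 12 (⇑E₄ * ⇑E₄ * ⇑E₄) (⇑E₄ * ⇑E₄ * ⇑E₄) := by
    have := (h4.mul h4).mul h4
    rwa [show (4 + 4 + 4 : ℤ) = 12 by norm_num] at this
  have h66 : SRel M σ l 12 (⇑E₆ * ⇑E₆) (⇑E₆ * ⇑E₆) := by
    have := h6.mul h6
    rwa [show (6 + 6 : ℤ) = 12 by norm_num] at this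
  have h := (h44.sub h66).smul (1/1728 : ℂ)
  have hs : σ (1/1728 : ℂ) = 1/1728 := by
    rw [map_div₀, map_one, map_ofNat]
  rw [hs] at h
  have e : ModularForm.discriminant = (1/1728 : ℂ) • ((⇑E₄ * ⇑E₄) * ⇑E₄ - ⇑E₆ * ⇑E₆) := by
    funext z
    rw [discriminant_eq_E₄_cube_sub_E₆_sq]
    simp only [Pi.smul_apply, Pi.sub_apply, Pi.mul_apply, smul_eq_mul]
    ring
  rw [e]
  exact h

lemma rel_levelOne {M : ℕ} (hM : 0 < M) (σ : ℂ →+* ℂ) (l : (ZMod M)ˣ) (n : ℕ) :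
    ∀ (w : ℤ) (_ : w ≤ n) (t : ModularForm 𝒮ℒ w), ∃ t' : ℍ → ℂ, SRel M σ l w t t' := by
  induction n with
  | zero =>
    intro w hw t
    rcases lt_or_eq_of_le hw with h | h
    · refine ⟨0, ?_⟩
      rw [ModularFormClass.levelOne_neg_weight_eq_zero (by simpa using h) t]
      exact SRel.zero w
    · have : w = 0 := by simpa using h
      subst this
      obtain ⟨c, hc⟩ := ModularFormClass.levelOne_weight_zero_const t
      refine ⟨σ c • 1, ?_⟩
      have : (⇑t : ℍ → ℂ) = c • 1 := by rw [hc]; ext; simp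
      rw [this]
      exact SRel.one.smul c
  | succ n ih =>
    intro w hw t
    by_cases hw' : w ≤ n
    · exact ih w hw' t
    · rcases Int.even_or_odd w with he | ho
      swap
      · refine ⟨0, ?_⟩
        rw [levelOne_odd_weight_eq_zero ho t]
        exact SRel.zero w
      · obtain ⟨k, rfl⟩ := Int.eq_ofNat_of_zero_le (show 0 ≤ w by omega)
        by_cases hk : 3 ≤ k
        swap
        · have : k = 2 := by
            have : Even k := by exact_mod_cast he
            obtain ⟨r, hr⟩ := this
            omega
          subst this
          refine ⟨0, ?_⟩
          have : t = 0 := rank_zero_iff_forall_zero.mp levelOne_weight_two_rank_zero t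
          rw [this]
          exact SRel.zero _
        · have he' : Even k := by exact_mod_cast he
          set a := (qExpansion 1 t).coeff 0 with ha
          set t1 : ModularForm 𝒮ℒ k := t - a • E hk with ht1
          have hcusp : (qExpansion 1 t1).coeff 0 = 0 := by
            rw [ht1, FunLike.coe_sub, ModularForm.qExpansion_sub,
              FunLike.coe_smul, ModularForm.qExpansion_smul, map_sub,
              PowerSeries.coeff_smul, E_qExpansion_coeff_zero hk he', smul_eq_mul, mul_one,
              sub_self]
            all_goals simp
          set t2 := CuspForm.discriminantEquiv (toCuspForm t1 hcusp)
          have e : (t : ℍ → ℂ) = discriminant * ⇑t2 + a • ⇑(E hk) := by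
            have := discriminant_mul_discriminantEquiv (toCuspForm t1 hcusp)
            rw [this]
            show _ = ⇑t1 + _
            rw [ht1]
            ext z
            simp
          obtain ⟨t', ht'⟩ := ih (k - 12) (by omega) t2
          refine ⟨discriminant * t' + σ a • ⇑(E hk), ?_⟩
          rw [e]
          refine SRel.add ?_ ((rel_E hM hk he').smul a)
          have := (rel_disc (σ := σ) (l := l) hM).mul ht'
          simpa using this
end Part2

section Part3
open scoped Manifold
open EisensteinSeries
section
variable {M : ℕ} [NeZero M]

lemma tsum_resid (r : ZMod M) (F : ℤ → ℂ) :
    ∑' d : ℤ, (if (d : ZMod M) = r then F d else 0) = ∑' n : ℤ, F (r.val + M * n) := by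
  have hinj : Function.Injective (fun n : ℤ => (r.val : ℤ) + M * n) := by
    intro a b h
    have hM : (M : ℤ) ≠ 0 := by exact_mod_cast NeZero.ne M
    have := add_left_cancel h
    exact mul_left_cancel₀ hM this
  have key := hinj.tsum_eq (f := fun d : ℤ => if (d : ZMod M) = r then F d else 0) (by
    intro d hd
    have h1 : (d : ZMod M) = r := by
      by_contra h
      exact hd (by simp [h])
    have h2 : (M : ℤ) ∣ d - r.val := by
      rw [← ZMod.intCast_zmod_eq_zero_iff_dvd]
      simp [h1]
    obtain ⟨n, hn⟩ := h2
    exact ⟨n, by simp only; linarith⟩)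
  rw [← key]
  refine tsum_congr fun n => ?_
  simp

def Dsum (r : ZMod M) (w : ℂ) : ℂ :=
  ∑' d : ℤ, if (d : ZMod M) = r then ((w + d) ^ 3)⁻¹ else 0

lemma Dsum_eq (r : ZMod M) (w : ℂ) :
    Dsum r w = ((M : ℂ) ^ 3)⁻¹ * ∑' n : ℤ, (((w + r.val) / M + n) ^ 3)⁻¹ := by
  have hM : (M : ℂ) ≠ 0 := by exact_mod_cast NeZero.ne M
  unfold Dsum
  rw [tsum_resid r (fun d => ((w + d) ^ 3)⁻¹), ← tsum_mul_left]
  refine tsum_congr fun n => ?_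
  rw [← mul_inv, ← mul_pow]
  congr 2
  push_cast
  field_simp
  ring

variable (M) in
def kap : ℂ := 2 * M ^ 3 / (-2 * π * Complex.I) ^ 3

lemma std_val (r : ZMod M) : cexp (2 * π * Complex.I * (r.val : ℂ) / M) = ZMod.stdAddChar r := by
  have := ZMod.stdAddChar_coe (N := M) (r.val : ℤ)
  have h : ((r.val : ℤ) : ZMod M) = r := by simp
  rw [h] at this
  rw [this]
  push_cast
  rfl

lemma two_pi_ne : (-2 * (π : ℂ) * Complex.I) ≠ 0 := by
  simp [Real.pi_ne_zero]

lemma Dsum_upper (r : ZMod M) (w : ℂ) (hw : 0 < w.im) :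
    kap M * Dsum r w = ∑' m : ℕ, (m : ℂ) ^ 2 * (ZMod.stdAddChar r * cexp (2 * π * Complex.I * w / M)) ^ m := by
  have hM : (M : ℂ) ≠ 0 := by exact_mod_cast NeZero.ne M
  have hM0 : 0 < (M : ℝ) := by exact_mod_cast Nat.pos_of_ne_zero (NeZero.ne M)
  have hz : 0 < ((w + r.val) / M).im := by
    rw [Complex.div_natCast_im]
    simp only [Complex.add_im, Complex.natCast_im, add_zero]
    positivity
  have := qExpansion_identity (k := 2) (by norm_num) ⟨(w + r.val) / M, hz⟩
  simp only [one_div] at this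
  rw [Dsum_eq]
  have h3 : ∑' n : ℤ, (((w + r.val) / M + n) ^ 3)⁻¹ = _ := this
  rw [h3]
  have e : cexp (2 * π * Complex.I * ((w + r.val) / M)) = ZMod.stdAddChar r * cexp (2 * π * Complex.I * w / M) := by
    rw [← std_val, ← Complex.exp_add]
    congr 1; ring
  have e2 : cexp (2 * π * Complex.I * ((UpperHalfPlane.mk ((w + r.val) / M) hz : ℍ) : ℂ)) = ZMod.stdAddChar r * cexp (2 * π * Complex.I * w / M) := e
  rw [e2]
  simp only [kap]
  have := two_pi_ne
  simp only [show (2 + 1 : ℕ) = 3 by rfl, Nat.factorial]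
  push_cast
  field_simp

lemma Dsum_neg (r : ZMod M) (w : ℂ) : Dsum r (-w) = - Dsum (-r) w := by
  unfold Dsum
  rw [← tsum_neg, ← (Equiv.neg ℤ).tsum_eq]
  refine tsum_congr fun d => ?_
  simp only [Equiv.neg_apply, Int.cast_neg]
  simp only [neg_eq_iff_eq_neg]
  split_ifs
  · rw [← inv_neg]
    congr 1; ring
  · simp

lemma Dsum_zero_zero : Dsum (0 : ZMod M) 0 = 0 := by
  have := Dsum_neg (0 : ZMod M) 0
  simp only [neg_zero] at this
  linear_combination this / 2

lemma hasSum_sq_geom {u : ℂ} (hu : ‖u‖ < 1) :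
    HasSum (fun n : ℕ => (n : ℂ) ^ 2 * u ^ n) (u * (1 + u) / (1 - u) ^ 3) := by
  have h2 := (hasSum_choose_mul_geometric_of_norm_lt_one 2 hu).mul_left 2
  have h1 := (hasSum_choose_mul_geometric_of_norm_lt_one 1 hu).mul_left 3
  have h0 := (hasSum_choose_mul_geometric_of_norm_lt_one 0 hu)
  have h := (h2.sub h1).add h0
  have hu1 : 1 - u ≠ 0 := by
    intro h
    have : u = 1 := by linear_combination -h
    rw [this] at hu; simp at hu
  have e : 2 * (1 / (1 - u) ^ (2 + 1)) - 3 * (1 / (1 - u) ^ (1 + 1)) + 1 / (1 - u) ^ (0 + 1)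
      = u * (1 + u) / (1 - u) ^ 3 := by
    field_simp
    ring
  rw [← e]
  refine h.congr_fun fun n => ?_
  have : (((n + 2).choose 2 : ℕ) : ℂ) = (n + 2) * (n + 1) / 2 := by
    rw [Nat.cast_choose_two]; push_cast; ring
  rw [this]
  simp
  ring

lemma std_ne_one {r : ZMod M} (hr : r ≠ 0) : (ZMod.stdAddChar r : ℂ) ≠ 1 := by
  intro h
  apply hr
  have := ZMod.injective_stdAddChar (N := M)
  apply this
  rw [h, AddChar.map_zero_eq_one]

lemma std_norm (r : ZMod M) : ‖(ZMod.stdAddChar r : ℂ)‖ = 1 := by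
  exact AddChar.norm_apply _ _

lemma qnorm_lt {w : ℂ} (hw : 0 < w.im) : ‖cexp (2 * π * Complex.I * w / M)‖ < 1 := by
  have hM0 : 0 < (M : ℝ) := by exact_mod_cast Nat.pos_of_ne_zero (NeZero.ne M)
  rw [Complex.norm_exp, Real.exp_lt_one_iff, Complex.div_natCast_re]
  apply div_neg_of_neg_of_pos _ hM0
  simp
  positivity

lemma Dsum_zero (r : ZMod M) :
    kap M * Dsum r 0 = (ZMod.stdAddChar r : ℂ) * (1 + ZMod.stdAddChar r) / (1 - ZMod.stdAddChar r) ^ 3 := by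
  by_cases hr : r = 0
  · subst hr
    rw [Dsum_zero_zero]
    simp
  have hb : Summable fun d : ℤ => ‖(((0 : ℤ) * (0 : ℂ) + d) ^ (3 : ℤ))⁻¹‖ :=
    (linear_right_summable 0 0 (by norm_num)).norm
  have hl : Filter.Tendsto (fun y : ℝ => Dsum r (y * Complex.I)) (nhdsWithin 0 (Set.Ioi 0))
      (nhds (Dsum r 0)) := by
    unfold Dsum
    refine tendsto_tsum_of_dominated_convergence hb ?_ ?_
    · intro d
      split_ifs with hd
      · have hd0 : (d : ℂ) ≠ 0 := by
          intro h
          have : d = 0 := by exact_mod_cast h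
          subst this
          apply hr; rw [← hd]; simp
        have : ContinuousAt (fun y : ℝ => (((y : ℂ) * Complex.I + d) ^ 3)⁻¹) 0 := by
          apply ContinuousAt.inv₀
          · fun_prop
          · simpa using hd0
        have h := this.tendsto.mono_left (nhdsWithin_le_nhds (s := Set.Ioi (0 : ℝ)))
        simpa using h
      · exact tendsto_const_nhds
    · refine Filter.Eventually.of_forall fun y d => ?_
      split_ifs with hd
      · have hd0 : (d : ℝ) ≠ 0 := by
          intro h
          have : d = 0 := by exact_mod_cast h
          subst this
          apply hr; rw [← hd]; simp
        have hd1 : 0 < |(d : ℝ)| := abs_pos.mpr hd0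
        have h1 : |(d : ℝ)| ≤ ‖(y : ℂ) * Complex.I + d‖ := by
          have := Complex.abs_re_le_norm ((y : ℂ) * Complex.I + d)
          simpa using this
        have e : ‖(((0 : ℤ) * (0 : ℂ) + d) ^ (3 : ℤ))⁻¹‖ = (|(d : ℝ)| ^ 3)⁻¹ := by
          rw [norm_inv, norm_zpow]
          simp
        rw [e, norm_inv, norm_pow]
        gcongr
      · simp
  have hl' := (hl.const_mul (kap M))
  have hr' : Filter.Tendsto (fun y : ℝ => kap M * Dsum r (y * Complex.I)) (nhdsWithin 0 (Set.Ioi 0))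
      (nhds ((ZMod.stdAddChar r : ℂ) * (1 + ZMod.stdAddChar r) / (1 - ZMod.stdAddChar r) ^ 3)) := by
    have hc : ContinuousAt (fun y : ℝ => (ZMod.stdAddChar r * cexp (2 * π * Complex.I * (y * Complex.I) / M)) *
       (1 + ZMod.stdAddChar r * cexp (2 * π * Complex.I * (y * Complex.I) / M)) /
       (1 - ZMod.stdAddChar r * cexp (2 * π * Complex.I * (y * Complex.I) / M)) ^ 3) 0 := by
      apply ContinuousAt.div
      · fun_prop
      · fun_prop
      · simp
        rw [sub_eq_zero]
        exact (std_ne_one hr).symm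
    have h := hc.tendsto.mono_left (nhdsWithin_le_nhds (s := Set.Ioi (0 : ℝ)))
    simp only [ofReal_zero, zero_mul, mul_zero, zero_div, Complex.exp_zero, mul_one] at h
    refine h.congr' ?_
    filter_upwards [self_mem_nhdsWithin] with y hy
    have hy' : 0 < ((y : ℂ) * Complex.I).im := by simpa using hy
    rw [Dsum_upper r _ hy']
    refine (hasSum_sq_geom ?_).tsum_eq.symm
    rw [norm_mul, std_norm, one_mul]
    exact qnorm_lt hy'
  exact tendsto_nhds_unique hl' hr'
end
end Part3

section Part4
open scoped Manifold
open EisensteinSeries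
section
variable {M : ℕ} [NeZero M]

def eisTerm (r s : ZMod M) (τ : ℍ) (x : ℤ × ℤ) : ℂ :=
  if (x.1 : ZMod M) = r ∧ (x.2 : ZMod M) = s then (((x.1 : ℂ) * τ + x.2) ^ 3)⁻¹ else 0

def Eis (r s : ZMod M) (τ : ℍ) : ℂ := kap M * ∑' x : ℤ × ℤ, eisTerm r s τ x

omit [NeZero M] in
lemma eisTerm_summable (r s : ZMod M) (τ : ℍ) : Summable (eisTerm r s τ) := by
  have h := (summable_prod_eisSummand (k := 3) le_rfl τ).norm
  refine Summable.of_norm_bounded h fun x => ?_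
  unfold eisTerm
  split_ifs
  · apply le_of_eq
    congr 1
  · simp

lemma tsum_upper_pnat (r : ZMod M) (τ : ℍ) (c : ℕ+) :
    kap M * Dsum r ((c : ℕ) * τ) = ∑' m : ℕ+, ((m : ℕ) : ℂ) ^ 2 * ZMod.stdAddChar r ^ (m : ℕ) *
      (cexp (2 * π * Complex.I * τ / M)) ^ ((c : ℕ) * m) := by
  have him : 0 < (((c : ℕ) : ℂ) * τ).im := by
    simp; exact τ.im_pos
  rw [Dsum_upper r _ him, ← tsum_zero_pnat_eq_tsum_nat]
  · simp only [CharP.cast_eq_zero, ne_eq, OfNat.ofNat_ne_zero, not_false_eq_true, zero_pow, zero_mul, zero_add]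
    refine tsum_congr fun m => ?_
    have e : cexp (2 * π * Complex.I * ((c : ℕ) * τ) / M) = cexp (2 * π * Complex.I * τ / M) ^ (c : ℕ) := by
      rw [← Complex.exp_nat_mul _ (c : ℕ)]
      congr 1; ring
    rw [mul_pow, ← mul_assoc, pow_mul, e]
  · refine (hasSum_sq_geom ?_).summable
    rw [norm_mul, std_norm, one_mul]
    exact qnorm_lt him

def eisTerm2 (r s : ZMod M) (c m : ℕ) : ℂ :=
  (m : ℂ) ^ 2 * ((if (c : ZMod M) = r then (ZMod.stdAddChar s : ℂ) ^ m else 0) -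
    (if (c : ZMod M) = -r then (ZMod.stdAddChar (-s) : ℂ) ^ m else 0))

def eisCoeff (r s : ZMod M) (n : ℕ) : ℂ :=
  if n = 0 then (if r = 0 then (ZMod.stdAddChar s : ℂ) * (1 + ZMod.stdAddChar s) / (1 - ZMod.stdAddChar s) ^ 3 else 0)
  else ∑ x ∈ n.divisorsAntidiagonal, eisTerm2 r s x.1 x.2

lemma eisTerm2_summable (r s : ZMod M) {q : ℂ} (hq : ‖q‖ < 1) :
    Summable fun x : ℕ+ × ℕ+ => eisTerm2 r s x.1 x.2 * q ^ ((x.1 : ℕ) * x.2) := by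
  have h := ((summable_prod_mul_pow 2 hq).norm).mul_left 2
  refine Summable.of_norm_bounded h fun x => ?_
  unfold eisTerm2
  rw [mul_right_comm, norm_mul, mul_comm]
  gcongr
  refine (norm_sub_le _ _).trans ?_
  have h1 : ‖(if ((x.1 : ℕ) : ZMod M) = r then (ZMod.stdAddChar s : ℂ) ^ (x.2 : ℕ) else 0)‖ ≤ 1 := by
    split_ifs <;> simp
  have h2 : ‖(if ((x.1 : ℕ) : ZMod M) = -r then (ZMod.stdAddChar (-s) : ℂ) ^ (x.2 : ℕ) else 0)‖ ≤ 1 := by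
    split_ifs <;> simp
  linarith

lemma Eis_eq (r s : ZMod M) (τ : ℍ) : Eis r s τ = eisCoeff r s 0 +
    ∑' x : ℕ+ × ℕ+, eisTerm2 r s x.1 x.2 * cexp (2 * π * Complex.I * τ / M) ^ ((x.1 : ℕ) * x.2) := by
  set q := cexp (2 * π * Complex.I * τ / M) with hqdef
  have hq : ‖q‖ < 1 := qnorm_lt τ.im_pos
  have h1 : ∑' x : ℤ × ℤ, eisTerm r s τ x = ∑' c : ℤ, if (c : ZMod M) = r then Dsum s (c * τ) else 0 := by
    rw [(eisTerm_summable r s τ).tsum_prod]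
    refine tsum_congr fun c => ?_
    by_cases hc : (c : ZMod M) = r
    · simp [eisTerm, hc, Dsum]
    · simp [eisTerm, hc]
  have hs1 : Summable fun c : ℤ => if (c : ZMod M) = r then Dsum s (c * τ) else 0 := by
    refine (eisTerm_summable r s τ).prod.congr fun c => ?_
    by_cases hc : (c : ZMod M) = r
    · simp [eisTerm, hc, Dsum]
    · simp [eisTerm, hc]
  unfold Eis
  rw [h1, tsum_int_eq_zero_add_tsum_pnat hs1, mul_add, mul_add]
  have e0 : kap M * (if ((0 : ℤ) : ZMod M) = r then Dsum s ((0 : ℤ) * τ) else 0) = eisCoeff r s 0 := by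
    simp only [eisCoeff, Int.cast_zero, zero_mul, if_true]
    by_cases hr : r = 0
    · simp [hr, Dsum_zero]
    · simp [hr, Ne.symm hr]
  rw [e0, add_assoc]
  congr 1
  have hsp : ∀ (r s : ZMod M) , Summable fun c : ℕ+ × ℕ+ => ((c.2 : ℕ) : ℂ) ^ 2 *
      (if ((c.1 : ℕ) : ZMod M) = r then (ZMod.stdAddChar s : ℂ) ^ (c.2 : ℕ) else 0) * q ^ ((c.1 : ℕ) * c.2) := by
    intro r s
    have h := ((summable_prod_mul_pow 2 hq).norm)
    refine Summable.of_norm_bounded h fun x => ?_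
    rw [mul_right_comm, norm_mul]
    apply mul_le_of_le_one_right (norm_nonneg _)
    split_ifs <;> simp
  have ep : ∀ (r s : ZMod M), ∑' c : ℕ+, kap M * (if ((c : ℕ) : ZMod M) = r then Dsum s ((c : ℕ) * τ) else 0) =
      ∑' c : ℕ+ × ℕ+, ((c.2 : ℕ) : ℂ) ^ 2 *
      (if ((c.1 : ℕ) : ZMod M) = r then (ZMod.stdAddChar s : ℂ) ^ (c.2 : ℕ) else 0) * q ^ ((c.1 : ℕ) * c.2) := by
    intro r s
    rw [(hsp r s).tsum_prod]
    refine tsum_congr fun c => ?_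
    split_ifs with hc
    · rw [tsum_upper_pnat]
    · simp
  have e1 := ep r s
  have e2 := ep (-r) (-s)
  have e3 : ∑' c : ℕ+, (if (((-((c : ℕ) : ℤ) : ℤ)) : ZMod M) = r then Dsum s (((-((c : ℕ) : ℤ) : ℤ) : ℂ) * τ) else 0)
    = - ∑' c : ℕ+, (if ((c : ℕ) : ZMod M) = -r then Dsum (-s) ((c : ℕ) * τ) else 0) := by
    rw [← tsum_neg]
    refine tsum_congr fun c => ?_
    have : (((-((c : ℕ) : ℤ) : ℤ) : ZMod M) = r) ↔ (((c : ℕ) : ZMod M) = -r) := by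
      push_cast
      rw [neg_eq_iff_eq_neg]
    simp only [this]
    split_ifs
    · push_cast
      rw [neg_mul, Dsum_neg]
    · simp
  rw [e3, mul_neg, ← tsum_mul_left, ← tsum_mul_left, e2]
  have e1' : ∑' c : ℕ+, kap M * (if (((c : ℕ) : ℤ) : ZMod M) = r then Dsum s ((((c : ℕ) : ℤ) : ℂ) * τ) else 0) = ∑' c : ℕ+, kap M * (if ((c : ℕ) : ZMod M) = r then Dsum s ((c : ℕ) * τ) else 0) := by
    refine tsum_congr fun c => ?_
    simp
  rw [e1', e1, ← sub_eq_add_neg, ← (hsp r s).tsum_sub (hsp (-r) (-s))]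
  refine tsum_congr fun x => ?_
  unfold eisTerm2
  ring

lemma Eis_hasPS (r s : ZMod M) : HasPS M (Eis r s) (PowerSeries.mk (eisCoeff r s)) := by
  intro τ
  set q := cexp (2 * π * Complex.I * τ / M) with hqdef
  have hq : ‖q‖ < 1 := qnorm_lt τ.im_pos
  have hS := (eisTerm2_summable r s hq).hasSum
  rw [← sigmaAntidiagonalEquivProd.hasSum_iff] at hS
  have h1 : HasSum (fun n : ℕ+ => eisCoeff r s n * q ^ (n : ℕ))
     (∑' x : ℕ+ × ℕ+, eisTerm2 r s x.1 x.2 * q ^ ((x.1 : ℕ) * x.2)) := by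
    refine hS.sigma fun n => ?_
    have e : eisCoeff r s n * q ^ (n : ℕ) = ∑ x : (n : ℕ).divisorsAntidiagonal,
        eisTerm2 r s x.1.1 x.1.2 * q ^ (x.1.1 * x.1.2) := by
      rw [Finset.sum_coe_sort (n : ℕ).divisorsAntidiagonal (fun x => eisTerm2 r s x.1 x.2 * q ^ (x.1 * x.2))]
      unfold eisCoeff
      rw [if_neg n.ne_zero, Finset.sum_mul]
      refine Finset.sum_congr rfl fun x hx => ?_
      rw [(Nat.mem_divisorsAntidiagonal.mp hx).1]
    rw [e]
    exact hasSum_fintype _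
  have h2 : HasSum (fun n : ℕ => if n = 0 then 0 else eisCoeff r s n * q ^ n)
     (∑' x : ℕ+ × ℕ+, eisTerm2 r s x.1 x.2 * q ^ ((x.1 : ℕ) * x.2)) := by
    rw [← PNat.coe_injective.hasSum_iff]
    · refine h1.congr_fun fun n => ?_
      simp
    · intro n hn
      rw [if_pos]
      by_contra h
      exact hn ⟨⟨n, Nat.pos_of_ne_zero h⟩, rfl⟩
  have h3 : HasSum (fun n : ℕ => if n = 0 then eisCoeff r s 0 else 0) (eisCoeff r s 0) :=
    hasSum_ite_eq 0 _
  have h4 := h3.add h2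
  rw [← Eis_eq] at h4
  refine h4.congr_fun fun n => ?_
  have : cexp (2 * π * Complex.I * n * τ / M) = q ^ n := by
    rw [← Complex.exp_nat_mul]
    congr 1; ring
  rw [this]
  by_cases hn : n = 0
  · simp [hn]
  · simp [hn]
end
end Part4

section Part5
open scoped Manifold
open EisensteinSeries
lemma sl_det (γ : SL(2, ℤ)) : γ 0 0 * γ 1 1 - γ 0 1 * γ 1 0 = 1 := by
  have := γ.det_coe
  rwa [Matrix.det_fin_two] at this

def slEquiv (γ : SL(2, ℤ)) : ℤ × ℤ ≃ ℤ × ℤ where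
  toFun x := (x.1 * γ 0 0 + x.2 * γ 1 0, x.1 * γ 0 1 + x.2 * γ 1 1)
  invFun x := (x.1 * γ 1 1 - x.2 * γ 1 0, - x.1 * γ 0 1 + x.2 * γ 0 0)
  left_inv x := by
    have := sl_det γ
    ext
    · simp only; linear_combination x.1 * this
    · simp only; linear_combination x.2 * this
  right_inv x := by
    have := sl_det γ
    ext
    · simp only; linear_combination x.1 * this
    · simp only; linear_combination x.2 * this

section
variable {M : ℕ} [NeZero M]

omit [NeZero M] in
lemma slEquiv_mod (γ : SL(2, ℤ)) (r s : ZMod M) (x : ℤ × ℤ) :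
    ((((slEquiv γ x).1 : ℤ) : ZMod M) = r * (γ 0 0 : ℤ) + s * (γ 1 0 : ℤ) ∧
     (((slEquiv γ x).2 : ℤ) : ZMod M) = r * (γ 0 1 : ℤ) + s * (γ 1 1 : ℤ)) ↔
    ((x.1 : ZMod M) = r ∧ (x.2 : ZMod M) = s) := by
  have h : (((γ 0 0 * γ 1 1 - γ 0 1 * γ 1 0 : ℤ)) : ZMod M) = 1 := by rw [sl_det]; simp
  push_cast at h
  simp only [slEquiv, Equiv.coe_fn_mk]
  push_cast
  constructor
  · rintro ⟨h1, h2⟩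
    constructor
    · linear_combination (r - x.1) * h + (γ 1 1 : ZMod M) * h1 - (γ 1 0 : ZMod M) * h2
    · linear_combination (s - x.2) * h - (γ 0 1 : ZMod M) * h1 + (γ 0 0 : ZMod M) * h2
  · rintro ⟨rfl, rfl⟩
    exact ⟨rfl, rfl⟩

lemma Eis_slash (r s : ZMod M) (γ : SL(2, ℤ)) : (Eis r s) ∣[(3 : ℤ)] γ =
    Eis (r * ((γ 0 0 : ℤ) : ZMod M) + s * ((γ 1 0 : ℤ) : ZMod M))
      (r * ((γ 0 1 : ℤ) : ZMod M) + s * ((γ 1 1 : ℤ) : ZMod M)) := by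
  funext τ
  rw [ModularForm.SL_slash_apply]
  unfold Eis
  rw [← (slEquiv γ).tsum_eq (eisTerm (r * _ + _) _ τ), mul_assoc, ← tsum_mul_right]
  congr 1
  refine tsum_congr fun x => ?_
  unfold eisTerm
  have hm := slEquiv_mod γ r s x
  by_cases hx : (x.1 : ZMod M) = r ∧ (x.2 : ZMod M) = s
  · rw [if_pos hx, if_pos (hm.mpr hx)]
    have h1 := eisSummand_SL2_apply 3 ![x.1, x.2] γ τ
    simp only [eisSummand] at h1
    have hd := UpperHalfPlane.denom_ne_zero (Matrix.SpecialLinearGroup.toGL ((Matrix.SpecialLinearGroup.map (Int.castRingHom ℝ)) γ)) τ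
    have e1 : (((x.1 : ℂ) * ((γ • τ : ℍ) : ℂ) + x.2) ^ 3)⁻¹ = _ := h1
    rw [e1, mul_right_comm, ← zpow_add₀ hd]
    simp [slEquiv, Matrix.vecMul, dotProduct, Fin.sum_univ_two]
  · rw [if_neg hx, if_neg (fun h => hx (hm.mp h)), zero_mul]

lemma Eis_hasPS' (r s : ZMod M) {σ : ℂ →+* ℂ} {l : (ZMod M)ˣ}
    (hσ : ∀ x : ZMod M, σ (ZMod.stdAddChar x) = ZMod.stdAddChar ((l : ZMod M) * x)) :
    HasPS M (Eis r (l * s)) (PowerSeries.map σ (PowerSeries.mk (eisCoeff r s))) := by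
  convert Eis_hasPS r (l * s) using 1
  ext n
  simp only [PowerSeries.coeff_map, PowerSeries.coeff_mk]
  unfold eisCoeff
  split_ifs
  · simp [hσ]
  · simp
  · simp only [map_sum, eisTerm2, map_mul, map_pow, map_natCast, map_sub]
    refine Finset.sum_congr rfl fun x _ => ?_
    congr 2
    · split_ifs <;> simp [hσ]
    · split_ifs <;> simp [hσ]

lemma Eis_rel (r s : ZMod M) {σ : ℂ →+* ℂ} {l : (ZMod M)ˣ}
    (hσ : ∀ x : ZMod M, σ (ZMod.stdAddChar x) = ZMod.stdAddChar ((l : ZMod M) * x)) :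
    SRel M σ l 3 (Eis r s) (Eis r (l * s)) := by
  rintro γ γ' ⟨h1, h2, h3, h4⟩
  rw [Eis_slash, Eis_slash]
  refine ⟨_, Eis_hasPS _ _, ?_⟩
  have e1 : r * ((γ' 0 0 : ℤ) : ZMod M) + l * s * ((γ' 1 0 : ℤ) : ZMod M) =
      r * ((γ 0 0 : ℤ) : ZMod M) + s * ((γ 1 0 : ℤ) : ZMod M) := by
    linear_combination r * h1 + s * h3
  have e2 : r * ((γ' 0 1 : ℤ) : ZMod M) + l * s * ((γ' 1 1 : ℤ) : ZMod M) =
      l * (r * ((γ 0 1 : ℤ) : ZMod M) + s * ((γ 1 1 : ℤ) : ZMod M)) := by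
    linear_combination r * h2 + l * s * h4
  have := Eis_hasPS' (r * ((γ 0 0 : ℤ) : ZMod M) + s * ((γ 1 0 : ℤ) : ZMod M))
    (r * ((γ 0 1 : ℤ) : ZMod M) + s * ((γ 1 1 : ℤ) : ZMod M)) hσ
  rw [← e1, ← e2] at this
  convert this using 4
  · exact e1.symm
end
end Part5

section Part6
open scoped Manifold
section
variable {M : ℕ} [NeZero M]
lemma eisCoeff_one (r s : ZMod M) : eisCoeff r s 1 =
    (if 1 = r then (ZMod.stdAddChar s : ℂ) else 0) - (if 1 = -r then (ZMod.stdAddChar (-s) : ℂ) else 0) := by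
  simp [eisCoeff, eisTerm2]

lemma Eis_coeff_ext {r s r' s' : ZMod M} (h : Eis r s = Eis r' s') (n : ℕ) :
    eisCoeff r s n = eisCoeff r' s' n := by
  have h1 := Eis_hasPS r s
  rw [h] at h1
  have := h1.unique (Nat.pos_of_ne_zero (NeZero.ne M)) (Eis_hasPS r' s')
  simpa using congrArg (PowerSeries.coeff n) this

lemma zmod_small (hM : 3 ≤ M) : (1 : ZMod M) ≠ 0 ∧ (1 : ZMod M) ≠ -1 := by
  have h2 : ((2 : ℕ) : ZMod M) ≠ 0 := by
    rw [Ne, ZMod.natCast_eq_zero_iff]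
    intro h
    have := Nat.le_of_dvd (by norm_num) h
    omega
  have h1 : ((1 : ℕ) : ZMod M) ≠ 0 := by
    rw [Ne, ZMod.natCast_eq_zero_iff]
    intro h
    have := Nat.le_of_dvd (by norm_num) h
    omega
  constructor
  · simpa using h1
  · intro h
    apply h2
    push_cast
    linear_combination h

lemma Eis_sep01 (hM : 3 ≤ M) {r s : ZMod M} (h : Eis r s = Eis (0 : ZMod M) 1) : r = 0 ∧ s = 1 := by
  obtain ⟨h1, h2⟩ := zmod_small hM
  have hr : r = 0 := by
    by_contra hr
    have := Eis_coeff_ext h 0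
    simp only [eisCoeff, if_true, if_neg hr] at this
    have hz1 : (ZMod.stdAddChar (1 : ZMod M) : ℂ) ≠ 1 := std_ne_one h1
    have hz0 : (ZMod.stdAddChar (1 : ZMod M) : ℂ) ≠ 0 := by
      intro h0
      have := std_norm (1 : ZMod M)
      rw [h0] at this; simp at this
    have hz2 : (1 + ZMod.stdAddChar (1 : ZMod M) : ℂ) ≠ 0 := by
      intro h0
      have h3 : (ZMod.stdAddChar (1 + 1 : ZMod M) : ℂ) = 1 := by
        rw [AddChar.map_add_eq_mul]
        linear_combination (ZMod.stdAddChar (1 : ZMod M) - 1) * h0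
      refine std_ne_one ?_ h3
      intro h4
      exact h2 (by linear_combination h4)
    have hz3 : (1 - ZMod.stdAddChar (1 : ZMod M) : ℂ) ≠ 0 := by
      rw [sub_ne_zero]; exact hz1.symm
    have : (ZMod.stdAddChar (1 : ZMod M) : ℂ) * (1 + ZMod.stdAddChar (1 : ZMod M)) / (1 - ZMod.stdAddChar (1 : ZMod M)) ^ 3 ≠ 0 := by
      positivity
    simp_all
  refine ⟨hr, ?_⟩
  subst hr
  let γ : SL(2, ℤ) := ⟨!![1, 0; 1, 1], by simp⟩
  have h3 : Eis s s = Eis (1 : ZMod M) 1 := by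
    have e1 := Eis_slash 0 s γ
    have e2 := Eis_slash (0 : ZMod M) 1 γ
    rw [h, e2] at e1
    simpa [γ] using e1.symm
  have h4 := Eis_coeff_ext h3 1
  rw [eisCoeff_one, eisCoeff_one, if_pos rfl, if_neg h2, sub_zero] at h4
  have hz0 : (ZMod.stdAddChar (1 : ZMod M) : ℂ) ≠ 0 := by
    intro h0
    have := std_norm (1 : ZMod M)
    rw [h0] at this; simp at this
  by_contra hs
  rw [if_neg (Ne.symm hs)] at h4
  split_ifs at h4 with h5
  · rw [← h5] at h4
    apply hz0
    linear_combination -(1/2 : ℂ) * h4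
  · apply hz0
    rw [← h4]; simp

lemma Eis_sep10 (hM : 3 ≤ M) {r s : ZMod M} (h : Eis r s = Eis (1 : ZMod M) 0) : r = 1 ∧ s = 0 := by
  let γ : SL(2, ℤ) := ⟨!![0, 1; -1, 0], by simp⟩
  have h3 : Eis (-s) r = Eis (0 : ZMod M) 1 := by
    have e1 := Eis_slash r s γ
    have e2 := Eis_slash (1 : ZMod M) 0 γ
    rw [h, e2] at e1
    simpa [γ] using e1.symm
  have := Eis_sep01 hM h3
  simp at this
  exact ⟨this.2, this.1⟩
end

lemma exists_coprime_add (c d M : ℤ) (hc : c ≠ 0) (h : ∀ p : ℕ, p.Prime → (p : ℤ) ∣ c → (p : ℤ) ∣ d → ¬ (p : ℤ) ∣ M) :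
    ∃ t : ℤ, IsCoprime (d + t * M) c := by
  classical
  set S : Finset ℕ := c.natAbs.primeFactors.filter (fun p : ℕ => ¬ (p : ℤ) ∣ d) with hS
  refine ⟨∏ p ∈ S, (p : ℤ), ?_⟩
  rw [Int.isCoprime_iff_gcd_eq_one]
  by_contra hg
  obtain ⟨p, hp, hpd⟩ := Nat.exists_prime_and_dvd hg
  have hpc : (p : ℤ) ∣ c := (Int.natCast_dvd_natCast.mpr hpd).trans (Int.gcd_dvd_right _ _)
  have hpd' : (p : ℤ) ∣ d + (∏ p ∈ S, (p : ℤ)) * M :=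
    (Int.natCast_dvd_natCast.mpr hpd).trans (Int.gcd_dvd_left _ _)
  have hp' : Prime (p : ℤ) := Nat.prime_iff_prime_int.mp hp
  by_cases hd : (p : ℤ) ∣ d
  · have h1 := (Int.dvd_add_right hd).mp hpd'
    rcases hp'.dvd_or_dvd h1 with h2 | h2
    · obtain ⟨q, hq, hpq⟩ := hp'.exists_mem_finset_dvd h2
      rw [hS, Finset.mem_filter, Nat.mem_primeFactors] at hq
      have : p = q := (Nat.prime_dvd_prime_iff_eq hp hq.1.1).mp (Int.natCast_dvd_natCast.mp hpq)
      subst this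
      exact hq.2 hd
    · exact h p hp hpc hd h2
  · have hpS : p ∈ S := by
      rw [hS, Finset.mem_filter, Nat.mem_primeFactors]
      exact ⟨⟨hp, Int.natCast_dvd.mp hpc, by simpa using hc⟩, hd⟩
    have h1 : (p : ℤ) ∣ ∏ p ∈ S, (p : ℤ) := Finset.dvd_prod_of_mem (fun p : ℕ => (p : ℤ)) hpS
    exact hd ((Int.dvd_add_left (h1.mul_right M)).mp hpd')

lemma sl2_surj (M : ℕ) [NeZero M] (a b c d : ZMod M) (h : a * d - b * c = 1) :
    ∃ γ : SL(2, ℤ), ((γ 0 0 : ℤ) : ZMod M) = a ∧ ((γ 0 1 : ℤ) : ZMod M) = b ∧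
      ((γ 1 0 : ℤ) : ZMod M) = c ∧ ((γ 1 1 : ℤ) : ZMod M) = d := by
  obtain ⟨a0, rfl⟩ := ZMod.intCast_surjective a
  obtain ⟨b0, rfl⟩ := ZMod.intCast_surjective b
  obtain ⟨d0, rfl⟩ := ZMod.intCast_surjective d
  obtain ⟨c1, rfl⟩ := ZMod.intCast_surjective c
  have hM : (M : ℤ) ≠ 0 := by exact_mod_cast NeZero.ne M
  obtain ⟨c0, hc0, hc⟩ : ∃ c0 : ℤ, c0 ≠ 0 ∧ (c0 : ZMod M) = c1 := by
    by_cases h0 : c1 = 0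
    · exact ⟨M, hM, by simp [h0]⟩
    · exact ⟨c1, h0, rfl⟩
  rw [← hc] at h ⊢
  have hdvd : (M : ℤ) ∣ a0 * d0 - b0 * c0 - 1 := by
    rw [← ZMod.intCast_zmod_eq_zero_iff_dvd]
    push_cast
    linear_combination h
  obtain ⟨t, u, v, huv⟩ := exists_coprime_add c0 d0 M hc0 (by
    intro p hp h1 h2 h3
    have h4 := h3.trans hdvd
    have h5 : (p : ℤ) ∣ 1 := by
      have := ((h2.mul_left a0).sub (h1.mul_left b0)).sub h4
      simpa using this
    have := Int.natCast_dvd_natCast.mp (by exact_mod_cast h5 : (p : ℤ) ∣ ((1 : ℕ) : ℤ))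
    exact hp.one_lt.ne' (Nat.dvd_one.mp this))
  set k := a0 * v + b0 * u
  have hz : (u : ZMod M) * d0 + v * c0 = 1 := by
    have := congrArg (Int.cast : ℤ → ZMod M) huv
    push_cast at this
    simpa using this
  refine ⟨⟨!![u + k * c0, -v + k * (d0 + t * M); c0, d0 + t * M], ?_⟩, ?_, ?_, ?_, ?_⟩
  · rw [Matrix.det_fin_two_of]
    linear_combination huv
  · simp [k]
    linear_combination a0 * hz - (u : ZMod M) * h
  · simp [k]
    linear_combination b0 * hz + (v : ZMod M) * h
  · simp
  · simp
end Part6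

section Part7
open scoped Manifold
/-- invariance under the principal congruence subgroup, with expansions at all cusps -/
def Nice (M : ℕ) (w : ℤ) (F : ℍ → ℂ) : Prop :=
  (∀ γ : SL(2, ℤ), γ ∈ CongruenceSubgroup.Gamma M → F ∣[w] γ = F) ∧ ∀ γ : SL(2, ℤ), ∃ p, HasPS M (F ∣[w] γ) p

def redM (M : ℕ) : SL(2, ℤ) →* SL(2, ZMod M) := Matrix.SpecialLinearGroup.map (Int.castRingHom (ZMod M))

lemma redM_apply (M : ℕ) (γ : SL(2, ℤ)) (i j : Fin 2) : redM M γ i j = ((γ i j : ℤ) : ZMod M) := rfl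

lemma redM_surj (M : ℕ) [NeZero M] : Function.Surjective (redM M) := by
  intro x
  have hd : x 0 0 * x 1 1 - x 0 1 * x 1 0 = 1 := by
    have := x.det_coe
    rwa [Matrix.det_fin_two] at this
  obtain ⟨γ, h1, h2, h3, h4⟩ := sl2_surj M _ _ _ _ hd
  refine ⟨γ, ?_⟩
  ext i j
  rw [redM_apply]
  fin_cases i <;> fin_cases j <;> assumption

def liftSL (M : ℕ) [NeZero M] (x : SL(2, ZMod M)) : SL(2, ℤ) := (redM_surj M x).choose

lemma redM_liftSL (M : ℕ) [NeZero M] (x : SL(2, ZMod M)) : redM M (liftSL M x) = x :=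
  (redM_surj M x).choose_spec

lemma Nice.congr {M : ℕ} {w : ℤ} {F : ℍ → ℂ} (h : Nice M w F) {γ γ' : SL(2, ℤ)}
    (hg : redM M γ = redM M γ') : F ∣[w] γ = F ∣[w] γ' := by
  have h1 : γ * γ'⁻¹ ∈ CongruenceSubgroup.Gamma M := by
    rw [Gamma_mem']
    change redM M (γ * γ'⁻¹) = 1
    rw [map_mul, map_inv, hg, mul_inv_cancel]
  have h2 := h.1 _ h1
  have h3 : γ = (γ * γ'⁻¹) * γ' := by group
  rw [h3, SlashAction.slash_mul, h2]

lemma Nice.mul {M : ℕ} {w v : ℤ} {F G : ℍ → ℂ} (h : Nice M w F) (h' : Nice M v G) : Nice M (w + v) (F * G) := by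
  constructor
  · intro γ hγ
    rw [ModularForm.mul_slash_SL2, h.1 γ hγ, h'.1 γ hγ]
  · intro γ
    obtain ⟨p, hp⟩ := h.2 γ
    obtain ⟨r, hr⟩ := h'.2 γ
    exact ⟨p * r, by rw [ModularForm.mul_slash_SL2]; exact hp.mul hr⟩

lemma Nice.prod {ι : Type*} {M : ℕ} (s : Finset ι) {w : ℤ} {F : ι → ℍ → ℂ}
    (h : ∀ i ∈ s, Nice M w (F i)) : Nice M (s.card * w) (∏ i ∈ s, F i) := by
  classical
  induction s using Finset.induction_on with
  | empty =>
    simp only [Finset.card_empty, Nat.cast_zero, zero_mul, Finset.prod_empty]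
    have h1 : HasPS M 1 1 := by
      have := HasPS.const M 1
      rw [map_one] at this
      exact this
    exact ⟨fun γ _ => by rw [ModularForm.is_invariant_one],
      fun γ => ⟨1, by rw [ModularForm.is_invariant_one]; exact h1⟩⟩
  | insert i s hi ih =>
    rw [Finset.prod_insert hi, Finset.card_insert_of_notMem hi]
    have := (h i (by simp)).mul (ih fun j hj => h j (by simp [hj]))
    convert this using 1
    push_cast
    ring

lemma prod_slash_sl {ι : Type*} (s : Finset ι) {w : ℤ} (F : ι → ℍ → ℂ) (γ : SL(2, ℤ)) :
    (∏ i ∈ s, F i) ∣[(s.card : ℤ) * w] γ = ∏ i ∈ s, (F i ∣[w] γ) := by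
  classical
  induction s using Finset.induction_on with
  | empty =>
    simp only [Finset.card_empty, Nat.cast_zero, zero_mul, Finset.prod_empty]
    rw [ModularForm.is_invariant_one]
  | insert i s hi ih =>
    rw [Finset.prod_insert hi, Finset.prod_insert hi, Finset.card_insert_of_notMem hi, ← ih,
      ← ModularForm.mul_slash_SL2]
    congr 1
    push_cast
    ring

lemma Eis_nice {M : ℕ} [NeZero M] (r s : ZMod M) : Nice M 3 (Eis r s) := by
  constructor
  · intro γ hγ
    rw [Gamma_mem] at hγ
    obtain ⟨h1, h2, h3, h4⟩ := hγ
    rw [Eis_slash]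
    erw [h1, h2, h3, h4]
    simp
  · intro γ
    rw [Eis_slash]
    exact ⟨_, Eis_hasPS _ _⟩

lemma HasPS.sum {ι : Type*} {M : ℕ} (s : Finset ι) {F : ι → ℍ → ℂ} {p : ι → PowerSeries ℂ}
    (h : ∀ i ∈ s, HasPS M (F i) (p i)) : HasPS M (∑ i ∈ s, F i) (∑ i ∈ s, p i) := by
  classical
  induction s using Finset.induction_on with
  | empty => simpa using HasPS.zero M
  | insert i s hi ih =>
    rw [Finset.sum_insert hi, Finset.sum_insert hi]
    exact (h i (by simp)).add (ih fun j hj => h j (by simp [hj]))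

lemma HasPS.prod {ι : Type*} {M : ℕ} (s : Finset ι) {F : ι → ℍ → ℂ} {p : ι → PowerSeries ℂ}
    (h : ∀ i ∈ s, HasPS M (F i) (p i)) : HasPS M (∏ i ∈ s, F i) (∏ i ∈ s, p i) := by
  classical
  induction s using Finset.induction_on with
  | empty =>
    have := HasPS.const M 1
    rw [map_one] at this
    simp only [Finset.prod_empty]; exact this
  | insert i s hi ih =>
    rw [Finset.prod_insert hi, Finset.prod_insert hi]
    exact (h i (by simp)).mul (ih fun j hj => h j (by simp [hj]))

instance instFintypeSLM (M : ℕ) [NeZero M] : Fintype (SL(2, ZMod M)) := Fintype.ofFinite _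

lemma trace_levelOne {M : ℕ} [NeZero M] {w : ℤ} {Φ : ℍ → ℂ} (h : Nice M w Φ) :
    ∃ t : ModularForm 𝒮ℒ w, ⇑t = ∑ y : SL(2, ZMod M), Φ ∣[w] liftSL M y := by
  have hM : 0 < M := Nat.pos_of_ne_zero (NeZero.ne M)
  set T : ℍ → ℂ := ∑ y : SL(2, ZMod M), Φ ∣[w] liftSL M y with hT
  have hinv : ∀ γ : SL(2, ℤ), T ∣[w] γ = T := by
    intro γ
    rw [hT, SlashAction.sum_slash, ← Equiv.sum_comp (Equiv.mulRight (redM M γ)) (fun y => Φ ∣[w] liftSL M y)]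
    refine Finset.sum_congr rfl fun y _ => ?_
    rw [← SlashAction.slash_mul]
    apply h.congr
    simp [redM_liftSL]
  choose p hp using h.2
  have hps : HasPS M T (∑ y : SL(2, ZMod M), p (liftSL M y)) := HasPS.sum _ fun y _ => hp _
  refine ⟨{ toFun := T, slash_action_eq' := ?_, holo' := hps.mdiff hM, bdd_at_cusps' := ?_ }, rfl⟩
  · rintro _ ⟨γ, rfl⟩
    exact hinv γ
  · intro c hc
    rw [OnePoint.isBoundedAt_iff_forall_SL2Z hc]
    intro γ _
    rw [hinv]
    exact hps.bdd hM
end Part7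

section Part8
open scoped Manifold
def vrow {M : ℕ} (x : SL(2, ZMod M)) : ZMod M × ZMod M :=
  open scoped Classical in if x 1 0 = 0 ∧ x 1 1 = 1 then (1, 0) else (0, 1)

def EP {M : ℕ} [NeZero M] (x : SL(2, ZMod M)) : ℍ → ℂ := Eis (vrow x).1 (vrow x).2

def EQ {M : ℕ} [NeZero M] (x : SL(2, ZMod M)) : ℍ → ℂ :=
  Eis ((vrow x).1 * x 0 0 + (vrow x).2 * x 1 0) ((vrow x).1 * x 0 1 + (vrow x).2 * x 1 1)

lemma EP_slash {M : ℕ} [NeZero M] (x : SL(2, ZMod M)) : EP x ∣[(3 : ℤ)] liftSL M x = EQ x := by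
  unfold EP EQ
  rw [Eis_slash]
  simp only [← redM_apply, redM_liftSL]

lemma EP_ne_EQ {M : ℕ} [NeZero M] (hM : 3 ≤ M) (x : SL(2, ZMod M)) (hx : x ≠ 1) : EQ x ≠ EP x := by
  intro h
  unfold EP EQ at h
  by_cases hc : x 1 0 = 0 ∧ x 1 1 = 1
  · have hv : vrow x = (1, 0) := by unfold vrow; rw [if_pos hc]
    rw [hv] at h
    obtain ⟨h1, h2⟩ := Eis_sep10 hM h
    apply hx
    ext i j
    fin_cases i <;> fin_cases j <;> simp_all
  · have hv : vrow x = (0, 1) := by unfold vrow; rw [if_neg hc]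
    rw [hv] at h
    obtain ⟨h1, h2⟩ := Eis_sep01 hM h
    apply hc
    simp_all

lemma key {M : ℕ} [NeZero M] (hM : 3 ≤ M) {σ : ℂ →+* ℂ} {l : (ZMod M)ˣ}
    (hσ : ∀ x : ZMod M, σ (ZMod.stdAddChar x) = ZMod.stdAddChar ((l : ZMod M) * x))
    {k : ℤ} {F : ℍ → ℂ} (hF : Nice M k F) :
    ∃ (w : ℤ) (H H' G G' : ℍ → ℂ), SRel M σ l w H H' ∧ SRel M σ l (w + k) G G' ∧ H * F = G ∧
      ∃ p, p ≠ 0 ∧ HasPS M H p := by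
  classical
  set T : Finset (SL(2, ZMod M)) := Finset.univ.erase 1 with hT
  set H : ℍ → ℂ := ∏ x ∈ T, (EP x - EQ x) with hH
  have hHps : ∃ p, p ≠ 0 ∧ HasPS M H p := by
    have h1 : ∀ x : SL(2, ZMod M), ∃ p, HasPS M (EP x - EQ x) p ∧ (x ≠ 1 → p ≠ 0) := by
      intro x
      obtain ⟨a, ha⟩ : ∃ a, HasPS M (EP x) a := ⟨_, Eis_hasPS _ _⟩
      obtain ⟨b, hb⟩ : ∃ a, HasPS M (EQ x) a := ⟨_, Eis_hasPS _ _⟩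
      refine ⟨a + (-1 : ℂ) • b, ?_, ?_⟩
      · have := ha.add (hb.smul (-1))
        have e : EP x + (-1 : ℂ) • EQ x = EP x - EQ x := by
          rw [_root_.neg_smul, one_smul, sub_eq_add_neg]
        rwa [e] at this
      · intro hx h0
        have : a = b := by
          rw [_root_.neg_smul, one_smul] at h0
          exact add_neg_eq_zero.mp h0
        subst this
        exact EP_ne_EQ hM x hx (hb.func_eq ha)
    choose p hp hp0 using h1
    refine ⟨∏ x ∈ T, p x, ?_, HasPS.prod _ fun x _ => hp x⟩
    exact Finset.prod_ne_zero_iff.mpr fun x hx => hp0 x (Finset.ne_of_mem_erase hx)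
  have hP : ∀ x : SL(2, ZMod M), ∃ P', SRel M σ l 3 (EP x) P' := fun x => ⟨_, Eis_rel _ _ hσ⟩
  have hQ : ∀ x : SL(2, ZMod M), ∃ P', SRel M σ l 3 (EQ x) P' := fun x => ⟨_, Eis_rel _ _ hσ⟩
  choose P' hP' using hP
  choose Q' hQ' using hQ
  have hrel := SRel.prod T (fun x hx => (hP' x).sub (hQ' x))
  have ht : ∀ S : Finset (SL(2, ZMod M)), ∃ t : ModularForm 𝒮ℒ (S.card * 3 + k),
      ⇑t = ∑ y : SL(2, ZMod M), ((∏ x ∈ S, EP x) * F) ∣[(S.card * 3 + k : ℤ)] liftSL M y := fun S =>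
    trace_levelOne ((Nice.prod S fun x _ => Eis_nice _ _).mul hF)
  choose t ht using ht
  have ht' : ∀ S, ∃ t', SRel M σ l (S.card * 3 + k) (t S) t' := fun S =>
    rel_levelOne (by omega) σ l (S.card * 3 + k).toNat _ (Int.self_le_toNat _) _
  choose t' ht' using ht'
  have hrelG : ∀ S ∈ T.powerset, SRel M σ l (T.card * 3 + k)
      ((∏ x ∈ T \ S, ((-1 : ℂ) • EQ x)) * t S) ((∏ x ∈ T \ S, (σ (-1) • Q' x)) * t' S) := by
    intro S hS
    have := (SRel.prod (T \ S) (fun x _ => (hQ' x).smul (-1))).mul (ht' S)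
    convert this using 1
    have := Finset.card_sdiff_add_card_eq_card (Finset.mem_powerset.mp hS)
    have : (T.card : ℤ) = (T \ S).card + S.card := by exact_mod_cast this.symm
    rw [this]; ring
  refine ⟨_, H, _, _, _, hrel, SRel.sum _ hrelG, ?_, hHps⟩
  have e1 : ∀ y : SL(2, ZMod M), y ≠ 1 →
      (∏ x ∈ T, ((EP x ∣[(3 : ℤ)] liftSL M y) + (-1 : ℂ) • EQ x)) * (F ∣[k] liftSL M y) = 0 := by
    intro y hy
    rw [Finset.prod_eq_zero (i := y) (Finset.mem_erase.mpr ⟨hy, Finset.mem_univ _⟩), zero_mul]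
    rw [EP_slash, _root_.neg_smul, one_smul, add_neg_cancel]
  have e2 : (∏ x ∈ T, ((EP x ∣[(3 : ℤ)] liftSL M 1) + (-1 : ℂ) • EQ x)) * (F ∣[k] liftSL M 1)
      = H * F := by
    have h1 : redM M (liftSL M 1) = redM M 1 := by rw [redM_liftSL, map_one]
    rw [hF.congr h1, SlashAction.slash_one, hH]
    congr 1
    refine Finset.prod_congr rfl fun x _ => ?_
    rw [(show Nice M 3 (EP x) from Eis_nice _ _).congr h1, SlashAction.slash_one, _root_.neg_smul, one_smul,
      sub_eq_add_neg]
  have e3 : H * F = ∑ y : SL(2, ZMod M),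
      (∏ x ∈ T, ((EP x ∣[(3 : ℤ)] liftSL M y) + (-1 : ℂ) • EQ x)) * (F ∣[k] liftSL M y) := by
    rw [Finset.sum_eq_single 1 (fun y _ hy => e1 y hy) (by simp), e2]
  rw [e3]
  simp_rw [Finset.prod_add, Finset.sum_mul]
  rw [Finset.sum_comm]
  refine Finset.sum_congr rfl fun S _ => ?_
  rw [ht S, Finset.mul_sum]
  refine Finset.sum_congr rfl fun y _ => ?_
  rw [ModularForm.mul_slash_SL2, prod_slash_sl]
  ring
end Part8

section Part9
open scoped Manifold
section
variable {M : ℕ} [NeZero M] {σ : ℂ →+* ℂ} {l : (ZMod M)ˣ}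

lemma ps_map_ne_zero (σ : ℂ →+* ℂ) {p : PowerSeries ℂ} (hp : p ≠ 0) : PowerSeries.map σ p ≠ 0 := by
  intro h
  apply hp
  ext n
  have := congrArg (PowerSeries.coeff n) h
  rw [PowerSeries.coeff_map, map_zero] at this
  rw [map_zero]
  exact (map_eq_zero σ).mp this

lemma conjBy_one {γ : SL(2, ℤ)} (hγ : γ ∈ CongruenceSubgroup.Gamma M) : ConjBy M l 1 γ := by
  rw [Gamma_mem] at hγ
  obtain ⟨h1, h2, h3, h4⟩ := hγ
  refine ⟨?_, ?_, ?_, ?_⟩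
  · exact h1.trans (by simp)
  · exact h2.trans (by simp)
  · exact (congrArg _ h3).trans (by simp)
  · exact h4.trans (by simp)

lemma conj_coeffs (hM : 3 ≤ M)
    (hσ : ∀ x : ZMod M, σ (ZMod.stdAddChar x) = ZMod.stdAddChar ((l : ZMod M) * x))
    {k : ℤ} {F : ℍ → ℂ} (hF : Nice M k F) {p : PowerSeries ℂ} (hp : HasPS M F p)
    (hpσ : PowerSeries.map σ p = p) {γ γ' : SL(2, ℤ)} (hγ : ConjBy M l γ γ')
    {r : PowerSeries ℂ} (hr : HasPS M (F ∣[k] γ) r) :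
    HasPS M (F ∣[k] γ') (PowerSeries.map σ r) := by
  have hM0 : 0 < M := by omega
  obtain ⟨w, H, H', G, G', hH, hG, hHF, h0, hh0, hh⟩ := key hM hσ hF
  have e1 : H' * F = G' := by
    obtain ⟨h, h1, h2⟩ := hH 1 1 (conjBy_one (one_mem _))
    obtain ⟨g, g1, g2⟩ := hG 1 1 (conjBy_one (one_mem _))
    rw [SlashAction.slash_one] at h1 h2 g1 g2
    rw [← hHF] at g1
    have := g1.unique hM0 (h1.mul hp)
    rw [this, map_mul, hpσ] at g2
    exact (h2.mul hp).func_eq g2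
  obtain ⟨h, h1, h2⟩ := hH γ γ' hγ
  obtain ⟨g, g1, g2⟩ := hG γ γ' hγ
  have hne : h ≠ 0 := by
    rintro rfl
    have e2 : H ∣[w] γ = 0 := h1.func_eq (HasPS.zero M)
    have e3 : H = 0 := by
      have := congrArg (fun f : ℍ → ℂ => f ∣[w] γ⁻¹) e2
      simpa [← SlashAction.slash_mul] using this
    rw [e3] at hh
    exact hh0 (hh.unique hM0 (HasPS.zero M))
  obtain ⟨s, hs⟩ := hF.2 γ'
  rw [← hHF, ModularForm.mul_slash_SL2] at g1
  rw [← e1, ModularForm.mul_slash_SL2] at g2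
  have e4 := g1.unique hM0 (h1.mul hr)
  have e5 := g2.unique hM0 (h2.mul hs)
  rw [e4, map_mul] at e5
  have := mul_left_cancel₀ (ps_map_ne_zero σ hne) e5
  rw [this]
  exact hs

lemma const_fix (hM : 3 ≤ M)
    (hσ : ∀ x : ZMod M, σ (ZMod.stdAddChar x) = ZMod.stdAddChar ((l : ZMod M) * x))
    {k : ℤ} (hk : 1 ≤ k) {F : ℍ → ℂ} (hF : Nice M k F) {p : PowerSeries ℂ} (hp : HasPS M F p)
    {ε : ℂ} (hpσ : PowerSeries.map σ p = p + PowerSeries.C ε) : ε = 0 := by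
  have hM0 : 0 < M := by omega
  obtain ⟨w, H, H', G, G', hH, hG, hHF, h0, hh0, hh⟩ := key hM hσ hF
  obtain ⟨h, h1, h2⟩ := hH 1 1 (conjBy_one (one_mem _))
  obtain ⟨g, g1, g2⟩ := hG 1 1 (conjBy_one (one_mem _))
  have hHi : ∀ γ ∈ CongruenceSubgroup.Gamma M, H' ∣[w] γ = H' := by
    intro γ hγ
    obtain ⟨x, x1, x2⟩ := hH 1 γ (conjBy_one hγ)
    rw [x1.unique hM0 h1] at x2
    rw [x2.func_eq h2, SlashAction.slash_one]
  have hGi : ∀ γ ∈ CongruenceSubgroup.Gamma M, G' ∣[w + k] γ = G' := by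
    intro γ hγ
    obtain ⟨x, x1, x2⟩ := hG 1 γ (conjBy_one hγ)
    rw [x1.unique hM0 g1] at x2
    rw [x2.func_eq g2, SlashAction.slash_one]
  rw [SlashAction.slash_one] at h1 h2 g1 g2
  have hp2 : HasPS M (F + fun _ => ε) (p + PowerSeries.C ε) := hp.add (HasPS.const M ε)
  have e1 : H' * (F + fun _ => ε) = G' := by
    rw [← hHF] at g1
    have := g1.unique hM0 (h1.mul hp)
    rw [this, map_mul, hpσ] at g2
    exact (h2.mul hp2).func_eq g2
  by_contra hε
  have hz : H' = 0 := by
    funext τ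
    obtain ⟨j, hj⟩ := exists_nat_gt (1 / τ.im)
    have hj' : 1 < j * τ.im := by
      have := τ.im_pos
      rwa [div_lt_iff₀ this] at hj
    let γ : SL(2, ℤ) := ⟨!![1, 0; (M * j : ℤ), 1], by simp⟩
    have hγ : γ ∈ CongruenceSubgroup.Gamma M := by
      rw [Gamma_mem]
      simp [γ]
    have e2 := hGi γ hγ
    rw [← e1, ModularForm.mul_slash_SL2, hHi γ hγ, SlashAction.add_slash, hF.1 γ hγ] at e2
    have e3 := congrFun e2 τ
    simp only [Pi.mul_apply, Pi.add_apply] at e3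
    rw [ModularForm.SL_slash_apply] at e3
    have hden : denom γ τ = M * j * τ + 1 := by
      rw [ModularGroup.denom_apply]; simp [γ]
    rw [hden] at e3
    set z : ℂ := M * j * τ + 1 with hz
    have hz1 : 1 < ‖z‖ := by
      have h1 : z.im = M * j * τ.im := by simp [hz]
      have h2 := Complex.abs_im_le_norm z
      rw [h1] at h2
      have h3 := le_abs_self (M * j * τ.im : ℝ)
      have h4 : (1 : ℝ) ≤ M := by exact_mod_cast hM0
      nlinarith
    have hz2 : z ^ (-k) ≠ 1 := by
      intro h
      have h2 : ‖z‖ ^ (-k) = 1 := by rw [← norm_zpow, h, norm_one]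
      have h3 : ‖z‖ ^ (-k) < 1 := zpow_lt_one_of_neg₀ hz1 (by omega)
      linarith
    have e4 : H' τ * (ε * (z ^ (-k) - 1)) = 0 := by linear_combination e3
    rcases mul_eq_zero.mp e4 with h | h
    · exact h
    · exact absurd h (mul_ne_zero hε (sub_ne_zero.mpr hz2))
  rw [hz] at h2
  have hne : h ≠ 0 := by
    rw [h1.unique hM0 hh]; exact hh0
  exact ps_map_ne_zero σ hne (h2.unique hM0 (HasPS.zero M))
end
end Part9

section Part10
open scoped Manifold
lemma ext_equiv {A L ι : Type*} [Field A] [Field L] [Algebra A L] [IsAlgClosed L] {b : ι → L}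
    (hb : IsTranscendenceBasis A b) (τ : MvPolynomial ι A ≃+* MvPolynomial ι A) :
    ∃ σ : L ≃+* L, ∀ r, σ (MvPolynomial.aeval b r) = MvPolynomial.aeval b (τ r) := by
  let _ := IsAlgClosed.isAlgClosure_of_transcendence_basis b hb
  let e : Algebra.adjoin A (Set.range b) ≃+* Algebra.adjoin A (Set.range b) :=
    hb.1.aevalEquiv.symm.toRingEquiv.trans (τ.trans hb.1.aevalEquiv.toRingEquiv)
  refine ⟨IsAlgClosure.equivOfEquiv L L e, fun r => ?_⟩
  have h := IsAlgClosure.equivOfEquiv_algebraMap L L e (hb.1.aevalEquiv r)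
  rw [hb.1.algebraMap_aevalEquiv] at h
  rw [h]
  simp only [e, RingEquiv.trans_apply]
  erw [hb.1.algebraMap_aevalEquiv]
  congr 2
  exact hb.1.aevalEquiv.symm_apply_apply r

def shiftEquiv (ι A : Type*) [Field A] : MvPolynomial ι A ≃ₐ[A] MvPolynomial ι A :=
  AlgEquiv.ofAlgHom (MvPolynomial.aeval fun i => MvPolynomial.X i + 1)
    (MvPolynomial.aeval fun i => MvPolynomial.X i - 1) (by ext; simp) (by ext; simp)

lemma exists_hom_ne (K : Subfield ℂ) (x : ℂ) (hx : x ∉ K) :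
    ∃ σ : ℂ →+* ℂ, (∀ y ∈ K, σ y = y) ∧ σ x ≠ x := by
  by_cases hal : IsAlgebraic K x
  · let A := algebraicClosure K ℂ
    have hxA : x ∈ A := mem_algebraicClosure_iff.mpr hal
    have : IsAlgClosure K A := inferInstance
    have : Normal K A := inferInstance
    have : IsGalois K A := inferInstance
    have hx' : (⟨x, hxA⟩ : A) ∉ (⊥ : IntermediateField K A) := by
      rw [IntermediateField.mem_bot]
      rintro ⟨y, hy⟩
      apply hx
      have := congrArg (fun z : A => (z : ℂ)) hy
      simp only at this
      rw [← this]
      exact y.2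
    rw [InfiniteGalois.mem_bot_iff_fixed] at hx'
    push Not at hx'
    obtain ⟨s, hs⟩ := hx'
    obtain ⟨B, hB⟩ := exists_isTranscendenceBasis A ℂ
    obtain ⟨σ, hσ⟩ := ext_equiv hB (MvPolynomial.mapEquiv _ s.toRingEquiv)
    have hσA : ∀ z : A, σ (z : ℂ) = (s z : ℂ) := by
      intro z
      have := hσ (MvPolynomial.C z)
      simp at this
      exact this
    refine ⟨σ, ?_, ?_⟩
    · intro y hy
      have := hσA (algebraMap K A ⟨y, hy⟩)
      rw [s.commutes] at this
      exact this
    · intro h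
      apply hs
      apply Subtype.ext
      exact (hσA ⟨x, hxA⟩).symm.trans h
  · have h1 : AlgebraicIndepOn K id {x} := by
      exact (algebraicIndependent_singleton_iff (⟨x, rfl⟩ : ({x} : Set ℂ))).mpr hal
    obtain ⟨B, hB, hB2⟩ := exists_isTranscendenceBasis_superset h1
    obtain ⟨σ, hσ⟩ := ext_equiv hB2 (shiftEquiv B K).toRingEquiv
    refine ⟨σ, ?_, ?_⟩
    · intro y hy
      have := hσ (MvPolynomial.C ⟨y, hy⟩)
      simp [shiftEquiv] at this
      exact this
    · have := hσ (MvPolynomial.X ⟨x, hB rfl⟩)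
      simp [shiftEquiv] at this
      simp [this]
end Part10

section Part11
open scoped Manifold
lemma sigma_unit (M : ℕ) (hM : 0 < M) (σ : ℂ →+* ℂ) :
    ∃ i : ℕ, i.Coprime M ∧ ∀ z : ℂ, z ^ M = 1 → σ z = z ^ i := by
  have h := Complex.isPrimitiveRoot_exp M hM.ne'
  have : NeZero M := ⟨hM.ne'⟩
  have h2 := h.map_of_injective σ.injective
  obtain ⟨i, _, hi, hi2⟩ := (h.isPrimitiveRoot_iff).mp h2
  refine ⟨i, hi, fun z hz => ?_⟩
  obtain ⟨j, _, hj⟩ := h.eq_pow_of_pow_eq_one hz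
  rw [← hj, map_pow, ← hi2, ← pow_mul, ← pow_mul, Nat.mul_comm i j]

lemma exists_inv (M i : ℕ) (hM : 0 < M) (h : i.Coprime M) : ∃ j : ℕ, (i * j : ZMod M) = 1 := by
  have : NeZero M := ⟨hM.ne'⟩
  refine ⟨((i : ZMod M)⁻¹).val, ?_⟩
  rw [ZMod.natCast_zmod_val]
  exact ZMod.coe_mul_inv_eq_one i h

lemma sigma_std {M i : ℕ} [NeZero M] (h : i.Coprime M) {σ : ℂ →+* ℂ}
    (hσ : ∀ z : ℂ, z ^ M = 1 → σ z = z ^ i) (x : ZMod M) :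
    σ (ZMod.stdAddChar x) = ZMod.stdAddChar ((ZMod.unitOfCoprime i h : ZMod M) * x) := by
  rw [hσ, ← AddChar.map_nsmul_eq_pow, ZMod.coe_unitOfCoprime, nsmul_eq_mul]
  rw [← AddChar.map_nsmul_eq_pow, nsmul_eq_mul, ZMod.natCast_self, zero_mul, AddChar.map_zero_eq_one]

lemma exists_conj {M : ℕ} [NeZero M] (l : (ZMod M)ˣ) (γ : SL(2, ℤ)) : ∃ γ', ConjBy M l γ γ' := by
  have hd := sl_det γ
  obtain ⟨γ', h1, h2, h3, h4⟩ := sl2_surj M ((γ 0 0 : ℤ) : ZMod M) (l * ((γ 0 1 : ℤ) : ZMod M))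
    ((l⁻¹ : (ZMod M)ˣ) * ((γ 1 0 : ℤ) : ZMod M)) ((γ 1 1 : ℤ) : ZMod M) (by
      have := congrArg (Int.cast : ℤ → ZMod M) hd
      push_cast at this
      have e : (l : ZMod M) * (l⁻¹ : (ZMod M)ˣ) = 1 := l.mul_inv
      linear_combination this - ((γ 0 1 : ℤ) : ZMod M) * ((γ 1 0 : ℤ) : ZMod M) * e)
  refine ⟨γ', h1, h2, ?_, h4⟩
  have e : (l : ZMod M) * (l⁻¹ : (ZMod M)ˣ) = 1 := l.mul_inv
  linear_combination (l : ZMod M) * h3 + ((γ 1 0 : ℤ) : ZMod M) * e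

lemma form_nice {N M : ℕ} (hM : 0 < M) (hNM : N ∣ M) {k : ℤ} (f : ModularForm (Gamma1 N) k) :
    Nice M k f := by
  have : NeZero N := ⟨fun h => by subst h; exact hM.ne' (Nat.eq_zero_of_zero_dvd hNM)⟩
  have hinv : ∀ γ : SL(2, ℤ), γ ∈ CongruenceSubgroup.Gamma M → ⇑f ∣[k] γ = ⇑f := by
    intro γ hγ
    have h1 : γ ∈ Gamma1 N := by
      rw [Gamma_mem] at hγ
      obtain ⟨h1, h2, h3, h4⟩ := hγ
      rw [Gamma1_mem]
      have e := fun z : ℤ => map_intCast (ZMod.castHom hNM (ZMod N)) z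
      refine ⟨?_, ?_, ?_⟩
      · rw [← e, h1, map_one]
      · rw [← e, h4, map_one]
      · rw [← e, h3, map_zero]
    exact SlashInvariantFormClass.slash_action_eq f _ ⟨γ, h1, rfl⟩
  refine ⟨hinv, fun γ => ?_⟩
  apply hasPS_of_periodic hM
  · exact f.holo'.slash k _
  · exact ModularFormClass.bdd_at_infty_slash f γ
  · intro τ
    have hT := ModularGroup.coe_T_zpow (M : ℤ)
    have h1 : γ * ModularGroup.T ^ (M : ℤ) * γ⁻¹ ∈ CongruenceSubgroup.Gamma M := by
      apply (Gamma_normal M).conj_mem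
      rw [Gamma_mem]
      rw [hT]
      simp
    have h2 : (⇑f ∣[k] γ) ∣[k] (ModularGroup.T ^ (M : ℤ)) = ⇑f ∣[k] γ := by
      have := congrArg (fun F : ℍ → ℂ => F ∣[k] γ) (hinv _ h1)
      simp only [← SlashAction.slash_mul] at this
      rw [← SlashAction.slash_mul]
      convert this using 2
      group
    have h3 := congrFun h2 τ
    rw [ModularForm.SL_slash_apply] at h3
    rw [UpperHalfPlane.modular_T_zpow_smul, ModularGroup.denom_apply] at h3
    rw [hT] at h3
    simpa using h3
end Part11

section Part12
open scoped Manifold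
lemma form_fix {N M : ℕ} [NeZero M] (hM : 3 ≤ M) (hNM : N ∣ M) {k : ℤ} (hk : 1 ≤ k)
    (f : ModularForm (Gamma1 N) k) {a : ℕ → ℂ} (ha : HasExpansion 1 (⇑f) a)
    {σ : ℂ →+* ℂ} {l : (ZMod M)ˣ}
    (hσ : ∀ x : ZMod M, σ (ZMod.stdAddChar x) = ZMod.stdAddChar ((l : ZMod M) * x))
    (hσa : ∀ j, 1 ≤ j → σ (a j) = a j) :
    ∃ p, HasPS M (⇑f) p ∧ PowerSeries.map σ p = p := by
  have hM0 : 0 < M := by omega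
  have h1 := (hasPS_of_hasExpansion ha).up hM0
  rw [mul_one] at h1
  have h2 : PowerSeries.map σ (PowerSeries.mk a) = PowerSeries.mk a + PowerSeries.C (σ (a 0) - a 0) := by
    ext n
    rw [PowerSeries.coeff_map, map_add, PowerSeries.coeff_mk, PowerSeries.coeff_C]
    rcases Nat.eq_zero_or_pos n with rfl | hn
    · simp
    · rw [if_neg hn.ne', hσa n hn, add_zero]
  have h3 : PowerSeries.map σ (upPS M (PowerSeries.mk a)) =
      upPS M (PowerSeries.mk a) + PowerSeries.C (σ (a 0) - a 0) := by
    rw [map_upPS, h2]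
    ext n
    simp only [upPS, PowerSeries.coeff_mk, map_add, PowerSeries.coeff_C]
    rcases Nat.eq_zero_or_pos n with rfl | hn
    · simp
    · rw [if_neg hn.ne']
      split_ifs with h4 h5
      · exact absurd (Nat.div_eq_zero_iff.mp h5) (by
          rintro (h | h)
          · omega
          · exact absurd (Nat.le_of_dvd hn h4) (by omega))
      · rfl
      · simp
  have h4 := const_fix hM hσ hk (form_nice hM0 hNM f) h1 h3
  refine ⟨_, h1, ?_⟩
  rw [h3, h4, map_zero, add_zero]

lemma gamma0_coprime {N : ℕ} {γ : SL(2, ℤ)} (hγ : γ ∈ Gamma0 N) : IsCoprime (γ 1 1) (N : ℤ) := by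
  rw [Gamma0_mem, ZMod.intCast_zmod_eq_zero_iff_dvd] at hγ
  obtain ⟨t, ht⟩ := hγ
  have := sl_det γ
  refine ⟨γ 0 0, - γ 0 1 * t, ?_⟩
  rw [ht] at this
  linear_combination this

lemma slash_gamma0 {N m : ℕ} {k : ℤ} {χ : DirichletCharacter ℂ N} {hmdvd : m ∣ N}
    {χ₀ : DirichletCharacter ℂ m}
    (hχ₀ : χ = DirichletCharacter.changeLevel hmdvd χ₀)
    {f : ℍ → ℂ} (hχf : ∀ γ : SL(2, ℤ), γ ∈ Gamma0 N →
      f ∣[k] γ = χ ((γ 1 1 : ℤ) : ZMod N) • f) (γ : SL(2, ℤ)) (hγ : γ ∈ Gamma0 N) :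
    f ∣[k] γ = χ₀ ((γ 1 1 : ℤ) : ZMod m) • f := by
  rw [hχf γ hγ, hχ₀, DirichletCharacter.changeLevel_eq_cast_of_dvd' _ _ (gamma0_coprime hγ)]

lemma sigma_char {N M m : ℕ} [NeZero M] [NeZero N] (hM : 3 ≤ M) (hNM : N ∣ M) (hmN : m ∣ N) {k : ℤ}
    (f : ModularForm (Gamma1 N) k) {χ₀ : DirichletCharacter ℂ m}
    (hf : ∀ γ : SL(2, ℤ), γ ∈ Gamma0 N → ⇑f ∣[k] γ = χ₀ ((γ 1 1 : ℤ) : ZMod m) • ⇑f)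
    {σ : ℂ →+* ℂ} {l : (ZMod M)ˣ}
    (hσ : ∀ x : ZMod M, σ (ZMod.stdAddChar x) = ZMod.stdAddChar ((l : ZMod M) * x))
    {p : PowerSeries ℂ} (hp : HasPS M (⇑f) p) (hpσ : PowerSeries.map σ p = p) (hp0 : p ≠ 0)
    (x : ZMod m) : σ (χ₀ x) = χ₀ x := by
  by_cases hx : IsUnit x
  swap
  · rw [χ₀.map_nonunit hx, map_zero]
  have hM0 : 0 < M := by omega
  obtain ⟨u, rfl⟩ := hx
  obtain ⟨v, rfl⟩ := ZMod.unitsMap_surjective hmN u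
  obtain ⟨γ, h1, h2, h3, h4⟩ := sl2_surj N ((v⁻¹ : (ZMod N)ˣ) : ZMod N) 0 0 (v : ZMod N) (by
    rw [mul_zero, sub_zero]; exact v.inv_mul)
  obtain ⟨γ', hγ'⟩ := exists_conj l γ
  have e := fun z : ℤ => map_intCast (ZMod.castHom hNM (ZMod N)) z
  have hγ : γ ∈ Gamma0 N := by rw [Gamma0_mem]; exact h3
  have hγ0 : γ' ∈ Gamma0 N := by
    rw [Gamma0_mem]
    have := congrArg (ZMod.castHom hNM (ZMod N)) hγ'.2.2.1
    rw [map_mul, e, e] at this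
    have h5 := this.trans h3
    have hu : IsUnit (ZMod.castHom hNM (ZMod N) (l : ZMod M)) := l.isUnit.map _
    exact (hu.mul_right_eq_zero).mp h5
  have hd : ((γ' 1 1 : ℤ) : ZMod N) = v := by
    have := congrArg (ZMod.castHom hNM (ZMod N)) hγ'.2.2.2
    rw [e, e] at this
    exact this.trans h4
  have e' := fun z : ℤ => map_intCast (ZMod.castHom hmN (ZMod m)) z
  have hv : ((ZMod.unitsMap hmN v : (ZMod m)ˣ) : ZMod m) = ZMod.castHom hmN (ZMod m) (v : ZMod N) := rfl
  have hd1 : ((γ 1 1 : ℤ) : ZMod m) = (ZMod.unitsMap hmN v : (ZMod m)ˣ) := by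
    rw [hv, ← h4, e']
  have hd2 : ((γ' 1 1 : ℤ) : ZMod m) = (ZMod.unitsMap hmN v : (ZMod m)ˣ) := by
    rw [hv, ← hd, e']
  set t := χ₀ ((ZMod.unitsMap hmN v : (ZMod m)ˣ) : ZMod m) with ht
  have s1 : HasPS M (⇑f ∣[k] γ) (t • p) := by
    rw [hf γ hγ, hd1]; exact hp.smul _
  have s2 : HasPS M (⇑f ∣[k] γ') (t • p) := by
    rw [hf γ' hγ0, hd2]; exact hp.smul _
  have s3 := conj_coeffs hM hσ (form_nice hM0 hNM f) hp hpσ hγ' s1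
  have s4 := s3.unique hM0 s2
  rw [PowerSeries.smul_eq_C_mul, map_mul, hpσ, PowerSeries.map_C] at s4
  exact PowerSeries.C_injective (mul_right_cancel₀ hp0 s4)

lemma sigma_coeff {N M m d : ℕ} [NeZero M] (hM : 3 ≤ M) (hd : 0 < d) (hNM : M = d * N) {k : ℤ}
    (f : ModularForm (Gamma1 N) k) {χ₀ : DirichletCharacter ℂ m} (hmN : m ∣ N)
    (hf : ∀ γ : SL(2, ℤ), γ ∈ Gamma0 N → ⇑f ∣[k] γ = χ₀ ((γ 1 1 : ℤ) : ZMod m) • ⇑f)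
    {σ : ℂ →+* ℂ} {l : (ZMod M)ˣ}
    (hσ : ∀ x : ZMod M, σ (ZMod.stdAddChar x) = ZMod.stdAddChar ((l : ZMod M) * x))
    {p : PowerSeries ℂ} (hp : HasPS M (⇑f) p) (hpσ : PowerSeries.map σ p = p)
    (g : SL(2, ℤ)) {c : ℕ → ℂ} (hc : HasExpansion N (⇑f ∣[k] g) c) (j : ℕ)
    (hj : (l : ZMod M) * j = 1) (hCD : (N : ℤ) ∣ g 1 0 * g 1 1 * (j - 1)) (n : ℕ) :
    σ (c n) = χ₀ ((g 0 0 * g 1 1 - j * g 0 1 * g 1 0 : ℤ) : ZMod m) * c n := by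
  have hM0 : 0 < M := by omega
  have hNM' : N ∣ M := ⟨d, by rw [hNM]; ring⟩
  have h1 := (hasPS_of_hasExpansion hc).up hd
  rw [← hNM] at h1
  obtain ⟨g', hg'⟩ := exists_conj l g
  have h2 := conj_coeffs hM hσ (form_nice hM0 hNM' f) hp hpσ hg' h1
  have e := fun z : ℤ => map_intCast (ZMod.castHom hNM' (ZMod N)) z
  have en := fun z : ℕ => map_natCast (ZMod.castHom hNM' (ZMod N)) z
  have h10M : ((g' 1 0 : ℤ) : ZMod M) = j * ((g 1 0 : ℤ) : ZMod M) := by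
    have := hg'.2.2.1
    linear_combination (j : ZMod M) * this - ((g' 1 0 : ℤ) : ZMod M) * hj
  have h10 : ((g' 1 0 : ℤ) : ZMod N) = j * ((g 1 0 : ℤ) : ZMod N) := by
    have := congrArg (ZMod.castHom hNM' (ZMod N)) h10M
    rwa [map_mul, e, e, en] at this
  have h11 : ((g' 1 1 : ℤ) : ZMod N) = ((g 1 1 : ℤ) : ZMod N) := by
    have := congrArg (ZMod.castHom hNM' (ZMod N)) hg'.2.2.2
    rwa [e, e] at this
  have k10 : (g' * g⁻¹) 1 0 = g' 1 0 * g 1 1 - g' 1 1 * g 1 0 := by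
    rw [Matrix.SpecialLinearGroup.coe_mul, Matrix.mul_apply, Fin.sum_univ_two,
      Matrix.SpecialLinearGroup.SL2_inv_expl]
    simp; ring
  have k11 : (g' * g⁻¹) 1 1 = - g' 1 0 * g 0 1 + g' 1 1 * g 0 0 := by
    rw [Matrix.SpecialLinearGroup.coe_mul, Matrix.mul_apply, Fin.sum_univ_two,
      Matrix.SpecialLinearGroup.SL2_inv_expl]
    simp
  have hmem : g' * g⁻¹ ∈ Gamma0 N := by
    rw [Gamma0_mem, k10]
    have hz := (ZMod.intCast_zmod_eq_zero_iff_dvd _ N).mpr hCD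
    push_cast at hz ⊢
    rw [h10, h11]
    linear_combination hz
  have e' := fun z : ℤ => map_intCast (ZMod.castHom hmN (ZMod m)) z
  have hlr : (((g' * g⁻¹) 1 1 : ℤ) : ZMod m) =
      ((g 0 0 * g 1 1 - j * g 0 1 * g 1 0 : ℤ) : ZMod m) := by
    rw [← e', ← e']
    congr 1
    rw [k11]
    push_cast
    rw [h10, h11]
    ring
  have h3 : ⇑f ∣[k] g' = χ₀ ((g 0 0 * g 1 1 - j * g 0 1 * g 1 0 : ℤ) : ZMod m) • (⇑f ∣[k] g) := by
    have : g' = (g' * g⁻¹) * g := by group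
    rw [this, SlashAction.slash_mul, hf _ hmem, ModularForm.SL_smul_slash, hlr]
  rw [h3] at h2
  have h4 := h2.unique hM0 (h1.smul _)
  have h5 := congrArg (PowerSeries.coeff (d * n)) h4
  rw [PowerSeries.coeff_map, coeff_upPS d hd, PowerSeries.coeff_mk, PowerSeries.coeff_smul,
    coeff_upPS d hd, PowerSeries.coeff_mk, smul_eq_mul] at h5
  exact h5
end Part12

section Part13
open scoped Manifold
lemma zetaC_prim (n : ℕ) (hn : n ≠ 0) : IsPrimitiveRoot (zetaC n) n := Complex.isPrimitiveRoot_exp n hn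
lemma dvd_mul_div_gcd (x : ℤ) (n n' : ℕ) (h : n' = n / Int.gcd x n) : (n : ℤ) ∣ x * n' := by
  have h1 : Int.gcd x n ∣ n := by
    have := Int.gcd_dvd_right x n
    exact_mod_cast this
  obtain ⟨y, hy⟩ := Int.gcd_dvd_left x (n : ℤ)
  refine ⟨y, ?_⟩
  have h2 : (n' : ℤ) * Int.gcd x n = n := by
    rw [h]; exact_mod_cast Nat.div_mul_cancel h1
  calc x * n' = (Int.gcd x n * y) * n' := by rw [← hy]
    _ = n * y := by linear_combination y * h2

lemma div_gcd_pos (x : ℤ) (n n' : ℕ) (hn : 0 < n) (h : n' = n / Int.gcd x n) : 0 < n' := by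
  have h1 : Int.gcd x n ∣ n := by
    have := Int.gcd_dvd_right x n
    exact_mod_cast this
  rw [h]
  exact Nat.div_pos (Nat.le_of_dvd hn h1) (Nat.pos_of_dvd_of_pos h1 hn)

lemma div_gcd_dvd (x : ℤ) (n n' : ℕ) (h : n' = n / Int.gcd x n) : n' ∣ n := by
  have h1 : Int.gcd x n ∣ n := by
    have := Int.gcd_dvd_right x n
    exact_mod_cast this
  rw [h]
  exact Nat.div_dvd_of_dvd h1

lemma autFixes_congr {m' : ℕ} (hm : m' ≠ 0) {K : Subfield ℂ} {u v : ℕ} (h : (u : ZMod m') = v) :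
    autFixes m' K u ↔ autFixes m' K v := by
  have : zetaC m' ^ u = zetaC m' ^ v := by
    rw [ZMod.natCast_eq_natCast_iff'] at h
    have hp := (zetaC_prim m' hm).pow_eq_one
    rw [← Nat.mod_add_div u m', ← Nat.mod_add_div v m', pow_add, pow_add, pow_mul, pow_mul, hp, h]
    simp
  unfold autFixes
  rw [this]

lemma autFixes_one {m' : ℕ} {K : Subfield ℂ} : autFixes m' K 1 :=
  ⟨RingEquiv.refl _, by simp, fun x _ => rfl⟩

lemma autFixes_mul {m' : ℕ} {K : Subfield ℂ} {i u : ℕ} (hi : autFixes m' K i) :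
    autFixes m' K u ↔ autFixes m' K (i * u) := by
  obtain ⟨e, he, hf⟩ := hi
  set z : Qzeta m' := ⟨zetaC m', Subfield.subset_closure rfl⟩ with hz
  have he' : e z = z ^ i := Subtype.ext he
  constructor
  · rintro ⟨e2, h2, h3⟩
    have h2' : e2 z = z ^ u := Subtype.ext h2
    refine ⟨e2.trans e, ?_, ?_⟩
    · have : (e2.trans e) z = z ^ (i * u) := by
        rw [RingEquiv.trans_apply, h2', map_pow, he', pow_mul]
      exact congrArg Subtype.val this
    · intro x hx
      rw [RingEquiv.trans_apply, h3 x hx, hf x hx]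
  · rintro ⟨e2, h2, h3⟩
    have h2' : e2 z = z ^ (i * u) := Subtype.ext h2
    refine ⟨e2.trans e.symm, ?_, ?_⟩
    · have : (e2.trans e.symm) z = z ^ u := by
        rw [RingEquiv.trans_apply, h2', RingEquiv.symm_apply_eq, map_pow, he', pow_mul]
      exact congrArg Subtype.val this
    · intro x hx
      rw [RingEquiv.trans_apply, h3 x hx, RingEquiv.symm_apply_eq, hf x hx]

lemma autFixes_sigma {m' : ℕ} (hm : m' ≠ 0) {K : Subfield ℂ} {σ : ℂ →+* ℂ} (hK : ∀ x ∈ K, σ x = x)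
    {i j : ℕ} (hi : σ (zetaC m') = zetaC m' ^ i) (hij : ((i * j : ℕ) : ZMod m') = 1) :
    autFixes m' K i := by
  have hmem : zetaC m' ∈ Qzeta m' := Subfield.subset_closure rfl
  have h1 : ∀ x : Qzeta m', (σ.comp (Qzeta m').subtype) x ∈ Qzeta m' := by
    intro x
    have : Qzeta m' ≤ (Qzeta m').comap σ := by
      unfold Qzeta
      rw [Subfield.closure_le]
      rintro _ rfl
      change σ (zetaC m') ∈ Qzeta m'
      rw [hi]
      exact pow_mem hmem i
    exact this x.2
  have h2 : Qzeta m' ≤ (Qzeta m').map σ := by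
    conv_lhs => unfold Qzeta
    rw [Subfield.closure_le]
    rintro _ rfl
    refine ⟨zetaC m' ^ j, pow_mem hmem j, ?_⟩
    rw [map_pow, hi, ← pow_mul]
    have hp := (zetaC_prim m' hm).pow_eq_one
    have h3 : ((i * j : ℕ) : ZMod m') = (1 : ℕ) := by rw [hij, Nat.cast_one]
    rw [ZMod.natCast_eq_natCast_iff'] at h3
    conv_rhs => rw [← pow_one (zetaC m')]
    rw [← Nat.mod_add_div (i * j) m', h3, pow_add, pow_mul, hp, one_pow, mul_one]
    conv_rhs => rw [← Nat.mod_add_div 1 m', pow_add, pow_mul, hp, one_pow, mul_one]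
  let φ : Qzeta m' →+* Qzeta m' := (σ.comp (Qzeta m').subtype).codRestrict (Qzeta m') h1
  refine ⟨RingEquiv.ofBijective φ ⟨φ.injective, ?_⟩, ?_, ?_⟩
  · rintro ⟨y, hy⟩
    obtain ⟨x, hx, hxy⟩ := h2 hy
    exact ⟨⟨x, hx⟩, Subtype.ext hxy⟩
  · exact hi
  · intro x hx
    exact Subtype.ext (hK _ hx)

section
variable {m m' : ℕ} {χ₀ : DirichletCharacter ℂ m} {A B C D : ℤ}

lemma psi_congr (h : (m : ℤ) ∣ B * C * m') {u v : ℤ} (huv : (u : ZMod m') = v) :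
    ((A * D - u * B * C : ℤ) : ZMod m) = ((A * D - v * B * C : ℤ) : ZMod m) := by
  rw [← sub_eq_zero, ← Int.cast_sub, ZMod.intCast_zmod_eq_zero_iff_dvd]
  rw [← sub_eq_zero, ← Int.cast_sub, ZMod.intCast_zmod_eq_zero_iff_dvd] at huv
  obtain ⟨t, ht⟩ := huv
  obtain ⟨s, hs⟩ := h
  exact ⟨-s * t, by linear_combination (-B * C) * ht - t * hs⟩

lemma psi_mul (hdet : A * D - B * C = 1) {j : ℤ} (hj : (m : ℤ) ∣ C * D * (j - 1)) (u : ℤ) :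
    χ₀ ((A * D - u * B * C : ℤ) : ZMod m) * χ₀ ((A * D - j * B * C : ℤ) : ZMod m) =
      χ₀ ((A * D - (u * j) * B * C : ℤ) : ZMod m) := by
  rw [← map_mul, ← Int.cast_mul]
  congr 1
  rw [← sub_eq_zero, ← Int.cast_sub, ZMod.intCast_zmod_eq_zero_iff_dvd]
  obtain ⟨t, ht⟩ := hj
  refine ⟨A * B * (u - 1) * t, ?_⟩
  linear_combination A * B * (u - 1) * ht + (A * D - u * j * B * C) * hdet

open scoped Classical in
lemma cSum_zmod [NeZero m'] (K : Subfield ℂ) (ζ : ℂ) : cSum m m' χ₀ A B C D K ζ =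
    ∑ x : ZMod m', if IsUnit x ∧ autFixes m' K x.val
      then χ₀ (((A * D - (x.val : ℤ) * B * C : ℤ) : ZMod m)) * ζ ^ x.val else 0 := by
  unfold cSum
  refine Finset.sum_nbij' (fun u => (u : ZMod m')) ZMod.val ?_ ?_ ?_ ?_ ?_
  · simp
  · intro x _
    exact Finset.mem_range.mpr x.val_lt
  · intro u hu
    exact ZMod.val_cast_of_lt (Finset.mem_range.mp hu)
  · intro x _
    exact ZMod.natCast_zmod_val x
  · intro u hu
    rw [ZMod.val_cast_of_lt (Finset.mem_range.mp hu)]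
    congr

lemma pow_congr_zmod {m' : ℕ} {ζ : ℂ} (hζ : ζ ^ m' = 1) {u v : ℕ} (h : (u : ZMod m') = v) : ζ ^ u = ζ ^ v := by
  rw [ZMod.natCast_eq_natCast_iff'] at h
  rw [← Nat.mod_add_div u m', ← Nat.mod_add_div v m', pow_add, pow_add, pow_mul, pow_mul, hζ, h]
  simp

lemma sigma_cSum [NeZero m'] (hdet : A * D - B * C = 1) (hBC : (m : ℤ) ∣ B * C * m') {K : Subfield ℂ}
    {σ : ℂ →+* ℂ} (hK : ∀ x ∈ K, σ x = x) (hχ : ∀ x, σ (χ₀ x) = χ₀ x) {i j : ℕ}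
    (hi : ∀ z : ℂ, z ^ m' = 1 → σ z = z ^ i) (hij : ((i * j : ℕ) : ZMod m') = 1)
    (hj : (m : ℤ) ∣ C * D * (j - 1)) {ζ : ℂ} (hζ : ζ ^ m' = 1) :
    σ (cSum m m' χ₀ A B C D K ζ) =
      χ₀ ((A * D - j * B * C : ℤ) : ZMod m) * cSum m m' χ₀ A B C D K ζ := by
  classical
  have hm0 : m' ≠ 0 := NeZero.ne m'
  have haut : autFixes m' K i :=
    autFixes_sigma hm0 hK (hi _ (zetaC_prim m' hm0).pow_eq_one) hij
  have hij' : (i : ZMod m') * j = 1 := by rw [← hij]; push_cast; rfl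
  let U : (ZMod m')ˣ := ⟨i, j, hij', by rw [mul_comm]; exact hij'⟩
  rw [cSum_zmod, map_sum, Finset.mul_sum]
  refine Fintype.sum_equiv (Units.mulLeft U) _ _ fun x => ?_
  have hUx : Units.mulLeft U x = (i : ZMod m') * x := rfl
  rw [hUx]
  have hval : ((((i : ZMod m') * x).val : ℕ) : ZMod m') = ((i * x.val : ℕ) : ZMod m') := by
    rw [ZMod.natCast_zmod_val]; push_cast; rw [ZMod.natCast_zmod_val]
  have hcond : (IsUnit ((i : ZMod m') * x) ∧ autFixes m' K ((i : ZMod m') * x).val) ↔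
      (IsUnit x ∧ autFixes m' K x.val) := by
    rw [autFixes_congr hm0 hval, ← autFixes_mul haut]
    have : IsUnit ((i : ZMod m') * x) ↔ IsUnit x := U.isUnit_units_mul x
    rw [this]
  by_cases hc : IsUnit x ∧ autFixes m' K x.val
  · rw [if_pos hc, if_pos (hcond.mpr hc), map_mul, hχ, map_pow, hi ζ hζ, ← mul_assoc,
      mul_comm (χ₀ _) (χ₀ _), psi_mul hdet hj, ← pow_mul]
    congr 1
    · congr 1
      apply psi_congr hBC
      have := congrArg (fun y : ZMod m' => y * j) hval
      push_cast
      rw [hval]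
      push_cast
      linear_combination (-(x.val : ZMod m')) * hij'
    · exact (pow_congr_zmod hζ hval).symm
  · rw [if_neg hc, if_neg (fun h => hc (hcond.mp h)), map_zero, mul_zero]

lemma exists_cSum_ne [NeZero m'] (hdet : A * D - B * C = 1) (hBC : (m : ℤ) ∣ B * C * m') (K : Subfield ℂ) :
    ∃ ζ : ℂ, ζ ^ m' = 1 ∧ cSum m m' χ₀ A B C D K ζ ≠ 0 := by
  classical
  by_contra hcon
  push Not at hcon
  have hm0 : m' ≠ 0 := NeZero.ne m'
  have hmp : 0 < m' := Nat.pos_of_ne_zero hm0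
  let co : ℕ → ℂ := fun u => if IsUnit ((u : ℕ) : ZMod m') ∧ autFixes m' K u
      then χ₀ (((A * D - (u : ℤ) * B * C : ℤ) : ZMod m)) else 0
  let P : Polynomial ℂ := ∑ u ∈ Finset.range m', Polynomial.C (co u) * Polynomial.X ^ u
  have hP0 : P = 0 := by
    apply Polynomial.eq_zero_of_degree_lt_of_eval_finset_eq_zero (Polynomial.nthRootsFinset m' (1 : ℂ))
    · rw [(zetaC_prim m' hm0).card_nthRootsFinset]
      refine lt_of_le_of_lt (Polynomial.degree_sum_le _ _) ?_
      rw [Finset.sup_lt_iff (by exact WithBot.bot_lt_coe _)]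
      intro u hu
      refine lt_of_le_of_lt (Polynomial.degree_C_mul_X_pow_le _ _) ?_
      exact_mod_cast Finset.mem_range.mp hu
    · intro z hz
      rw [Polynomial.mem_nthRootsFinset hmp] at hz
      have := hcon z hz
      rw [← this]
      unfold cSum
      rw [Polynomial.eval_finsetSum]
      refine Finset.sum_congr rfl fun u _ => ?_
      simp only [co, Polynomial.eval_mul, Polynomial.eval_C, Polynomial.eval_pow, Polynomial.eval_X]
      split_ifs <;> simp
  have h1 : P.coeff (1 % m') = co (1 % m') := by
    simp only [P, Polynomial.finsetSum_coeff, Polynomial.coeff_C_mul_X_pow]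
    rw [Finset.sum_ite_eq, if_pos (Finset.mem_range.mpr (Nat.mod_lt _ hmp))]
  have h2 : ((1 % m' : ℕ) : ZMod m') = (1 : ℕ) := by simp
  have h3 : co (1 % m') = 1 := by
    simp only [co]
    rw [if_pos ⟨by rw [h2]; simp, (autFixes_congr hm0 h2).mpr autFixes_one⟩]
    have h4 : ((((1 % m' : ℕ) : ℤ)) : ZMod m') = ((1 : ℤ) : ZMod m') := by
      rw [Int.cast_natCast, h2]; simp
    rw [psi_congr hBC h4, one_mul, hdet]
    simp
  rw [hP0, Polynomial.coeff_zero, h3] at h1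
  exact zero_ne_one h1
end
end Part13

/-- Let `χ` be a Dirichlet character modulo `N` of conductor `m`, induced
by the primitive character `χ₀` modulo `m`, let `f ∈ M_k(Γ₀(N), χ)` and
`g = (A,B;C,D) ∈ SL₂(ℤ)`. Set `N' = N/gcd(CD,N)`, `m' = m/gcd(BC,m)`, `K = K_f(ζ_{N'})`,
and for an `m'`-th root of unity `ζ` put `c(ζ) = Σ_{μ ∈ G'} χ₀(AD − μ̃BC) ζ^{μ̃}`. Then
some `m'`-th root of unity `ζ` has `c(ζ) ≠ 0`, and for any such `ζ`, every Fourier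
coefficient of `f|_k g` lies in `c(ζ)·K`. -/
theorem stmt_10 (N : ℕ) (hN : 1 ≤ N) (k : ℤ) (hk : 1 ≤ k)
    (χ : DirichletCharacter ℂ N) (m : ℕ) (hm : m = χ.conductor)
    (hmdvd : m ∣ N) (χ₀ : DirichletCharacter ℂ m)
    (hχ₀ : χ = DirichletCharacter.changeLevel hmdvd χ₀)
    (f : ModularForm (Gamma1 N) k)
    (hχf : ∀ γ : SL(2, ℤ), γ ∈ Gamma0 N →
      ⇑f ∣[k] γ = χ ((γ 1 1 : ℤ) : ZMod N) • ⇑f)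
    (a : ℕ → ℂ) (ha : HasExpansion 1 (⇑f) a)
    (g : SL(2, ℤ)) (N' m' : ℕ)
    (hN' : N' = N / Int.gcd (g 1 0 * g 1 1) N)
    (hm' : m' = m / Int.gcd (g 0 1 * g 1 0) m)
    (K : Subfield ℂ)
    (hK : K = Subfield.closure ({x : ℂ | ∃ j : ℕ, 1 ≤ j ∧ x = a j} ∪ {zetaC N'}))
    (c : ℕ → ℂ) (hc : HasExpansion N (⇑f ∣[k] g) c) :
    (∃ ζ : ℂ, ζ ^ m' = 1 ∧ cSum m m' χ₀ (g 0 0) (g 0 1) (g 1 0) (g 1 1) K ζ ≠ 0) ∧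
    ∀ ζ : ℂ, ζ ^ m' = 1 → cSum m m' χ₀ (g 0 0) (g 0 1) (g 1 0) (g 1 1) K ζ ≠ 0 →
      ∀ n : ℕ, ∃ t ∈ K, c n = cSum m m' χ₀ (g 0 0) (g 0 1) (g 1 0) (g 1 1) K ζ * t := by
  have hm0 : 0 < m := Nat.pos_of_dvd_of_pos hmdvd hN
  have hm'0 : 0 < m' := div_gcd_pos _ _ _ hm0 hm'
  have hN'0 : 0 < N' := div_gcd_pos _ _ _ hN hN'
  have hN'd : N' ∣ N := div_gcd_dvd _ _ _ hN'
  have hm'd : m' ∣ m := div_gcd_dvd _ _ _ hm'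
  have : NeZero m' := ⟨hm'0.ne'⟩
  have : NeZero N := ⟨by omega⟩
  have hdet := sl_det g
  have hBC : (m : ℤ) ∣ g 0 1 * g 1 0 * m' := dvd_mul_div_gcd _ _ _ hm'
  have hCDN : (N : ℤ) ∣ g 1 0 * g 1 1 * N' := dvd_mul_div_gcd _ _ _ hN'
  refine ⟨exists_cSum_ne hdet hBC K, ?_⟩
  intro ζ hζ hne n
  set S := cSum m m' χ₀ (g 0 0) (g 0 1) (g 1 0) (g 1 1) K ζ with hS
  obtain ⟨M, hM⟩ : ∃ M, M = 3 * N := ⟨_, rfl⟩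
  have hM3 : 3 ≤ M := by omega
  have hM0 : 0 < M := by omega
  have : NeZero M := ⟨hM0.ne'⟩
  have hNM : N ∣ M := ⟨3, by omega⟩
  have hf := slash_gamma0 hχ₀ hχf
  refine ⟨c n / S, ?_, (mul_div_cancel₀ _ hne).symm⟩
  by_contra hcK
  obtain ⟨σ, hσK, hσ⟩ := exists_hom_ne K _ hcK
  obtain ⟨i, hi, hiz⟩ := sigma_unit M hM0 σ
  obtain ⟨j, hij⟩ := exists_inv M i hM0 hi
  have hstd := sigma_std hi hiz
  have haK : ∀ j, 1 ≤ j → σ (a j) = a j := by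
    intro j hj
    apply hσK
    rw [hK]
    exact Subfield.subset_closure (Or.inl ⟨j, hj, rfl⟩)
  obtain ⟨p, hp, hpσ⟩ := form_fix hM3 hNM hk f ha hstd haK
  by_cases hp0 : p = 0
  · have hf0 : ⇑f = 0 := by
      rw [hp0] at hp
      exact hp.func_eq (HasPS.zero M)
    have hc' := hasPS_of_hasExpansion hc
    rw [hf0, SlashAction.zero_slash] at hc'
    have h0 := hc'.unique hN (HasPS.zero N)
    have h1 := congrArg (PowerSeries.coeff n) h0
    rw [PowerSeries.coeff_mk, map_zero] at h1
    apply hσ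
    rw [h1, zero_div, map_zero]
  have hχ := sigma_char hM3 hNM hmdvd f hf hstd hp hpσ hp0
  have red : ∀ d : ℕ, d ∣ M → ((i * j : ℕ) : ZMod d) = 1 := by
    intro d hd
    have h1 := congrArg (ZMod.castHom hd (ZMod d)) hij
    rw [map_mul, map_natCast, map_natCast, map_one] at h1
    rw [Nat.cast_mul]
    exact h1
  have hjN : (N : ℤ) ∣ g 1 0 * g 1 1 * (j - 1) := by
    have hprim := zetaC_prim N' hN'0.ne'
    have hN'M : N' ∣ M := hN'd.trans hNM
    have h1 : zetaC N' ^ i = zetaC N' := by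
      rw [← hiz]
      · apply hσK
        rw [hK]
        exact Subfield.subset_closure (Or.inr rfl)
      · obtain ⟨t, ht⟩ := hN'M
        rw [ht, pow_mul, hprim.pow_eq_one, one_pow]
    have h2 : (i : ZMod N') = 1 := by
      have h3 : i ≡ 1 [MOD N'] := by
        have h4 : zetaC N' ^ i = zetaC N' ^ 1 := by rw [h1, pow_one]
        rw [hprim.eq_orderOf]
        exact (hprim.isOfFinOrder hN'0.ne').pow_inj_mod.mp h4
      have h6 := (ZMod.natCast_eq_natCast_iff _ _ _).mpr h3
      rwa [Nat.cast_one] at h6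
    have h3 := red N' hN'M
    rw [Nat.cast_mul, h2, one_mul] at h3
    have h4 : (N' : ℤ) ∣ (j : ℤ) - 1 := by
      rw [← ZMod.intCast_zmod_eq_zero_iff_dvd]
      push_cast
      rw [h3, sub_self]
    exact hCDN.trans (mul_dvd_mul_left _ h4)
  have hjm : (m : ℤ) ∣ g 1 0 * g 1 1 * (j - 1) := (Int.natCast_dvd_natCast.mpr hmdvd).trans hjN
  have hm'M : m' ∣ M := hm'd.trans (hmdvd.trans hNM)
  have hz : ∀ z : ℂ, z ^ m' = 1 → σ z = z ^ i := by
    intro z hz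
    apply hiz
    obtain ⟨t, ht⟩ := hm'M
    rw [ht, pow_mul, hz, one_pow]
  have hSσ := sigma_cSum hdet hBC hσK hχ hz (red m' hm'M) hjm hζ
  have hcσ := sigma_coeff hM3 (by norm_num) hM f hmdvd hf hstd hp hpσ g hc j
    (by rw [ZMod.coe_unitOfCoprime]; exact hij) hjN n
  rw [← hS] at hSσ
  have hψ : χ₀ ((g 0 0 * g 1 1 - j * g 0 1 * g 1 0 : ℤ) : ZMod m) ≠ 0 := by
    intro h0
    rw [h0, zero_mul] at hSσ
    exact hne ((map_eq_zero σ).mp hSσ)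
  apply hσ
  rw [map_div₀, hcσ, hSσ, mul_div_mul_left _ _ hψ]
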